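/- arXiv:2510.22578 — 2 statements merged into one kernel-verified Lean document; each statement's English description precedes it below -/
import Mathlib

section
/- There exist universal constants C₀, c₀, C > 0 such that the following holds for all positive integers k ≤ n and all m ≥ C₀·k·log(en/k). If A ∈ ℂ^{m×n} is a standard complex Gaussian random matrix, then with probability at least 1 − exp(−c₀·m): for every x ∈ ℂ^n and every x♯ ∈ ℂ^n satisfying |A x♯| = |A x| entrywise and ‖x♯‖₁ ≤ ‖z‖₁ for all z ∈ ℂ^n with |A z| = |A x| (that is, x♯ is a minimizer of the ℓ₁ norm subject to the phaseless constraint), one has dist₁(x♯, x) ≤ C·σ_k(x)₁ and dist(x♯, x) ≤ C·σ_k(x)₁/√k. -/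
open MeasureTheory ProbabilityTheory Real Finset

/-- The `ℓ_q` (quasi-)norm `(∑ i, ‖x i‖^q)^{1/q}` of a vector with entries in `𝕜 ∈ {ℝ, ℂ}`. -/
noncomputable def lpNorm {ι : Type*} [Fintype ι] {𝕜 : Type*} [RCLike 𝕜] (q : ℝ) (x : ι → 𝕜) : ℝ :=
  (∑ i, ‖x i‖ ^ q) ^ (1 / q)

open Classical in
/-- The number of nonzero entries of a vector. -/
noncomputable def l0Norm {ι : Type*} [Fintype ι] {𝕜 : Type*} [RCLike 𝕜] (x : ι → 𝕜) : ℕ :=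
  (Finset.univ.filter fun i => x i ≠ 0).card

/-- The phase distance `dist_q(x,y) = inf_{|c|=1} ‖x - c • y‖_q`. -/
noncomputable def phaseDist {ι : Type*} [Fintype ι] {𝕜 : Type*} [RCLike 𝕜] (q : ℝ)
    (x y : ι → 𝕜) : ℝ :=
  sInf {d | ∃ c : 𝕜, ‖c‖ = 1 ∧ d = lpNorm q (fun i => x i - c * y i)}

/-- The best `k`-term approximation error `σ_k(x)_q = inf {‖x - z‖_q : ‖z‖₀ ≤ k}`. -/
noncomputable def sigmaK {ι : Type*} [Fintype ι] {𝕜 : Type*} [RCLike 𝕜] (k : ℕ) (q : ℝ)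
    (x : ι → 𝕜) : ℝ :=
  sInf {d | ∃ z : ι → 𝕜, l0Norm z ≤ k ∧ d = lpNorm q (fun i => x i - z i)}

/-- The entrywise modulus `|Ax|` of the matrix-vector product `Ax`. -/
noncomputable def absMv {m n : ℕ} {𝕜 : Type*} [RCLike 𝕜] (A : Fin m → Fin n → 𝕜)
    (x : Fin n → 𝕜) : Fin m → ℝ :=
  fun i => ‖∑ j, A i j * x j‖

/-- `A` satisfies the phaseless bi-Lipschitz condition on `X` with constants `L, U`:
`L·dist(x,y) ≤ ‖|Ax| - |Ay|‖₂ ≤ U·dist(x,y)` for all `x, y ∈ X`. -/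
def PhaselessBiLip {m n : ℕ} {𝕜 : Type*} [RCLike 𝕜] (A : Fin m → Fin n → 𝕜)
    (X : Set (Fin n → 𝕜)) (L U : ℝ) : Prop :=
  ∀ x ∈ X, ∀ y ∈ X,
    L * phaseDist 2 x y ≤ lpNorm 2 (fun i => absMv A x i - absMv A y i) ∧
    lpNorm 2 (fun i => absMv A x i - absMv A y i) ≤ U * phaseDist 2 x y

/-- The law of a standard complex Gaussian random matrix `A ∈ ℂ^{m×n}`: the pushforward, under
the entrywise map `(x,y) ↦ x + i·y`, of the product over the `m·n` entries of the product of two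
real Gaussian measures with mean `0` and variance `1/2`. -/
noncomputable def gaussMatrixComplex (m n : ℕ) : Measure (Fin m → Fin n → ℂ) :=
  Measure.map (fun g : Fin m → Fin n → ℝ × ℝ => fun i j => ((g i j).1 : ℂ) + (g i j).2 * Complex.I)
    (Measure.pi fun _ : Fin m => Measure.pi fun _ : Fin n =>
      (gaussianReal 0 (1/2)).prod (gaussianReal 0 (1/2)))

/-- The squared Euclidean norm of a complex vector. -/
noncomputable def normSqSum {ι : Type*} [Fintype ι] (w : ι → ℂ) : ℝ := ∑ j, ‖w j‖ ^ 2

/-- The pairing of a row of complex Gaussians, given by real and imaginary parts, with a vector. -/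
noncomputable def rowForm {n : ℕ} (w : Fin n → ℂ) (g : Fin n → ℝ × ℝ) : ℂ :=
  ∑ j, (((g j).1 : ℂ) + (g j).2 * Complex.I) * w j

/-- The law of the real and imaginary parts of a row of the Gaussian matrix. -/
noncomputable def rowLaw (n : ℕ) : Measure (Fin n → ℝ × ℝ) :=
  Measure.pi fun _ : Fin n => (gaussianReal 0 (1/2)).prod (gaussianReal 0 (1/2))

instance (n : ℕ) : IsProbabilityMeasure (rowLaw n) := by
  unfold rowLaw; infer_instance

lemma normSqSum_nonneg {ι : Type*} [Fintype ι] (w : ι → ℂ) : 0 ≤ normSqSum w :=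
  Finset.sum_nonneg fun _ _ => by positivity

lemma measurable_rowForm {n : ℕ} (w : Fin n → ℂ) : Measurable (rowForm w) := by
  unfold rowForm
  fun_prop

lemma rowForm_re {n : ℕ} (w : Fin n → ℂ) (g : Fin n → ℝ × ℝ) :
    (rowForm w g).re = ∑ j, ((g j).1 * (w j).re + (g j).2 * (-(w j).im)) := by
  simp [rowForm, Complex.add_re, Complex.mul_re, sub_eq_add_neg]

lemma map_rowForm_re {n : ℕ} (w : Fin n → ℂ) :
    (rowLaw n).map (fun g => (rowForm w g).re) =
      gaussianReal 0 (Real.toNNReal (normSqSum w / 2)) := by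
  have hmeas : Measurable fun g => (rowForm w g).re :=
    Complex.measurable_re.comp (measurable_rowForm w)
  have : IsProbabilityMeasure ((rowLaw n).map (fun g => (rowForm w g).re)) :=
    Measure.isProbabilityMeasure_map hmeas.aemeasurable
  apply Measure.ext_of_charFun
  ext t
  have hv : ((Real.toNNReal (normSqSum w / 2) : NNReal) : ℝ) = normSqSum w / 2 :=
    Real.coe_toNNReal _ (by have := normSqSum_nonneg w; positivity)
  rw [charFun_gaussianReal, charFun_apply_real, integral_map hmeas.aemeasurable (by fun_prop)]
  have hg : ∀ s : ℝ, ∫ x : ℝ, Complex.exp (s * x * Complex.I) ∂(gaussianReal 0 (1/2)) =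
      Complex.exp (-(s ^ 2 / 4)) := by
    intro s
    have := charFun_gaussianReal (μ := 0) (v := 1/2) s
    rw [charFun_apply_real] at this
    rw [this]
    congr 1
    push_cast
    ring
  have hfac : ∀ g : Fin n → ℝ × ℝ, Complex.exp (t * ((rowForm w g).re : ℂ) * Complex.I) =
      ∏ j, (Complex.exp (((t * (w j).re : ℝ) : ℂ) * (g j).1 * Complex.I) *
        Complex.exp (((-(t * (w j).im) : ℝ) : ℂ) * (g j).2 * Complex.I)) := by
    intro g
    rw [rowForm_re]
    simp_rw [← Complex.exp_add]
    rw [← Complex.exp_sum]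
    congr 1
    push_cast
    rw [Finset.mul_sum, Finset.sum_mul]
    refine Finset.sum_congr rfl fun j _ => ?_
    ring
  simp_rw [hfac]
  rw [rowLaw, integral_fintype_prod_eq_prod (𝕜 := ℂ) (fun j (p : ℝ × ℝ) =>
    Complex.exp (((t * (w j).re : ℝ) : ℂ) * p.1 * Complex.I) *
        Complex.exp (((-(t * (w j).im) : ℝ) : ℂ) * p.2 * Complex.I))]
  have hj : ∀ j, ∫ p : ℝ × ℝ, Complex.exp (((t * (w j).re : ℝ) : ℂ) * p.1 * Complex.I) *
        Complex.exp (((-(t * (w j).im) : ℝ) : ℂ) * p.2 * Complex.I)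
        ∂((gaussianReal 0 (1/2)).prod (gaussianReal 0 (1/2))) =
        Complex.exp (((-(t ^ 2 * ‖w j‖ ^ 2 / 4) : ℝ) : ℂ)) := by
    intro j
    rw [integral_prod_mul (fun x : ℝ => Complex.exp (((t * (w j).re : ℝ) : ℂ) * x * Complex.I))
      (fun x : ℝ => Complex.exp (((-(t * (w j).im) : ℝ) : ℂ) * x * Complex.I)), hg, hg,
      ← Complex.exp_add, Complex.sq_norm, Complex.normSq_apply]
    congr 1
    push_cast
    ring
  simp_rw [hj]
  rw [← Complex.exp_sum, hv]
  congr 1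
  unfold normSqSum
  push_cast
  rw [Finset.sum_neg_distrib, ← Finset.sum_div, ← Finset.mul_sum]
  ring

lemma integral_even_pow_gaussianReal (p : ℕ) :
    ∫ x, x ^ (2 * p) ∂(gaussianReal 0 1) = 2 ^ p * Real.Gamma (p + 1 / 2) / √π := by
  rw [integral_gaussianReal_eq_integral_smul one_ne_zero]
  have h1 : ∀ x : ℝ, gaussianPDFReal 0 1 x • x ^ (2 * p) =
      (fun y : ℝ => (√(2 * π))⁻¹ * (y ^ ((2 * p : ℕ) : ℝ) * rexp (-(1/2) * y ^ (2:ℝ)))) |x| := by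
    intro x
    simp only [gaussianPDFReal, smul_eq_mul, NNReal.coe_one, mul_one, sub_zero, Real.rpow_natCast,
      Real.rpow_two, sq_abs, Even.pow_abs (even_two_mul p)]
    ring_nf
  rw [integral_congr_ae (.of_forall h1), integral_comp_abs
    (f := fun y : ℝ => (√(2 * π))⁻¹ * (y ^ ((2 * p : ℕ) : ℝ) * rexp (-(1/2) * y ^ (2:ℝ)))),
    integral_const_mul,
    integral_rpow_mul_exp_neg_mul_rpow (by norm_num)
      (by have : (0:ℝ) ≤ ((2 * p : ℕ) : ℝ) := by positivity
          linarith) (by norm_num)]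
  have e1 : (((2 * p : ℕ) : ℝ) + 1) / 2 = p + 1 / 2 := by push_cast; ring
  rw [neg_div, e1, Real.rpow_neg (by norm_num), Real.rpow_add (by norm_num), Real.rpow_natCast,
    ← Real.sqrt_eq_rpow, Real.sqrt_mul (by norm_num), one_div, Real.sqrt_inv, inv_pow]
  have : √2 * √2 = 2 := Real.mul_self_sqrt (by norm_num)
  field_simp

lemma integral_pow_four_gaussianReal : ∫ x, x ^ 4 ∂(gaussianReal 0 1) = 3 := by
  rw [show (4:ℕ) = 2 * 2 from rfl, integral_even_pow_gaussianReal, Real.Gamma_nat_add_half]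
  have : √π ≠ 0 := by positivity
  field_simp
  norm_num [Nat.doubleFactorial]

lemma integral_pow_eight_gaussianReal : ∫ x, x ^ 8 ∂(gaussianReal 0 1) = 105 := by
  rw [show (8:ℕ) = 2 * 4 from rfl, integral_even_pow_gaussianReal, Real.Gamma_nat_add_half]
  have : √π ≠ 0 := by positivity
  field_simp
  norm_num [Nat.doubleFactorial]

lemma gaussianReal_eq_map_sqrt {v : ℝ} (hv : 0 ≤ v) :
    gaussianReal 0 (Real.toNNReal v) = (gaussianReal 0 1).map (fun x => √v * x) := by
  rw [gaussianReal_map_const_mul]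
  congr 1
  · simp
  · ext; simp [hv]

lemma integral_rowForm_re_pow {n : ℕ} (w : Fin n → ℂ) (p : ℕ) :
    ∫ g, (rowForm w g).re ^ p ∂(rowLaw n) =
      √(normSqSum w / 2) ^ p * ∫ x, x ^ p ∂(gaussianReal 0 1) := by
  have hmeas : Measurable fun g => (rowForm w g).re :=
    Complex.measurable_re.comp (measurable_rowForm w)
  rw [← integral_map (f := fun x : ℝ => x ^ p) hmeas.aemeasurable (by fun_prop), map_rowForm_re,
    gaussianReal_eq_map_sqrt (by have := normSqSum_nonneg w; positivity),
    integral_map (by fun_prop) (by fun_prop), ← integral_const_mul]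
  simp_rw [mul_pow]

lemma integrable_rowForm_re_pow {n : ℕ} (w : Fin n → ℂ) (p : ℕ) :
    Integrable (fun g => (rowForm w g).re ^ p) (rowLaw n) := by
  have hmeas : Measurable fun g => (rowForm w g).re :=
    Complex.measurable_re.comp (measurable_rowForm w)
  have h := (memLp_id_gaussianReal (μ := 0) (v := Real.toNNReal (normSqSum w / 2)) p)
  rw [← map_rowForm_re] at h
  have h2 := (MemLp.integrable_norm_pow' h)
  have h3 : Integrable (fun x : ℝ => x ^ p) ((rowLaw n).map (fun g => (rowForm w g).re)) := by
    refine h2.congr' (by fun_prop) ?_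
    simp
  exact h3.comp_measurable hmeas

lemma rowForm_const_mul {n : ℕ} (c : ℂ) (w : Fin n → ℂ) (g : Fin n → ℝ × ℝ) :
    rowForm (fun j => c * w j) g = c * rowForm w g := by
  simp only [rowForm, Finset.mul_sum]
  exact Finset.sum_congr rfl fun j _ => by ring

lemma rowForm_add {n : ℕ} (u v : Fin n → ℂ) (g : Fin n → ℝ × ℝ) :
    rowForm (fun j => u j + v j) g = rowForm u g + rowForm v g := by
  simp only [rowForm, ← Finset.sum_add_distrib]
  exact Finset.sum_congr rfl fun j _ => by ring

lemma normSqSum_const_mul {ι : Type*} [Fintype ι] (c : ℂ) (w : ι → ℂ) :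
    normSqSum (fun j => c * w j) = ‖c‖ ^ 2 * normSqSum w := by
  simp only [normSqSum, Finset.mul_sum, norm_mul, mul_pow]

lemma normSqSum_add {ι : Type*} [Fintype ι] (u v : ι → ℂ) :
    normSqSum (fun j => u j + v j) =
      normSqSum u + normSqSum v + 2 * (∑ j, u j * starRingEnd ℂ (v j)).re := by
  simp only [normSqSum, Complex.re_sum, Finset.mul_sum, ← Finset.sum_add_distrib]
  refine Finset.sum_congr rfl fun j _ => ?_
  simp only [Complex.sq_norm, Complex.normSq_apply, Complex.add_re, Complex.add_im,
    Complex.mul_re, Complex.conj_re, Complex.conj_im]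
  ring

lemma rowForm_im_eq_re {n : ℕ} (w : Fin n → ℂ) (g : Fin n → ℝ × ℝ) :
    (rowForm w g).im = (rowForm (fun j => -Complex.I * w j) g).re := by
  rw [rowForm_const_mul]
  simp

lemma integrable_rowForm_im_pow {n : ℕ} (w : Fin n → ℂ) (p : ℕ) :
    Integrable (fun g => (rowForm w g).im ^ p) (rowLaw n) := by
  simp_rw [rowForm_im_eq_re]
  exact integrable_rowForm_re_pow _ p

lemma integral_rowForm_re_pow_four {n : ℕ} (w : Fin n → ℂ) :
    ∫ g, (rowForm w g).re ^ 4 ∂(rowLaw n) = 3 / 4 * normSqSum w ^ 2 := by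
  rw [integral_rowForm_re_pow, integral_pow_four_gaussianReal,
    show (4:ℕ) = 2 * 2 from rfl, pow_mul, Real.sq_sqrt (by have := normSqSum_nonneg w; positivity)]
  ring

lemma integral_rowForm_re_pow_eight {n : ℕ} (w : Fin n → ℂ) :
    ∫ g, (rowForm w g).re ^ 8 ∂(rowLaw n) = 105 / 16 * normSqSum w ^ 4 := by
  rw [integral_rowForm_re_pow, integral_pow_eight_gaussianReal,
    show (8:ℕ) = 2 * 4 from rfl, pow_mul, Real.sq_sqrt (by have := normSqSum_nonneg w; positivity)]
  ring

lemma norm_rowForm_pow_four {n : ℕ} (w : Fin n → ℂ) (g : Fin n → ℝ × ℝ) :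
    ‖rowForm w g‖ ^ 4 = 2 / 3 * ((rowForm w g).re ^ 4 + (rowForm w g).im ^ 4 +
      ((rowForm (fun j => (1 + Complex.I) * w j) g).re ^ 4 +
        (rowForm (fun j => (1 - Complex.I) * w j) g).re ^ 4) / 4) := by
  rw [rowForm_const_mul, rowForm_const_mul, show (4:ℕ) = 2 * 2 from rfl, pow_mul, Complex.sq_norm,
    Complex.normSq_apply]
  simp
  ring

lemma integrable_norm_rowForm_pow_four {n : ℕ} (w : Fin n → ℂ) :
    Integrable (fun g => ‖rowForm w g‖ ^ 4) (rowLaw n) := by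
  simp_rw [norm_rowForm_pow_four]
  have h1 := integrable_rowForm_re_pow w 4
  have h2 := integrable_rowForm_im_pow w 4
  have h3 := integrable_rowForm_re_pow (fun j => (1 + Complex.I) * w j) 4
  have h4 := integrable_rowForm_re_pow (fun j => (1 - Complex.I) * w j) 4
  fun_prop

lemma integral_norm_rowForm_pow_four {n : ℕ} (w : Fin n → ℂ) :
    ∫ g, ‖rowForm w g‖ ^ 4 ∂(rowLaw n) = 2 * normSqSum w ^ 2 := by
  simp_rw [norm_rowForm_pow_four]
  have h1 := integrable_rowForm_re_pow w 4
  have h2 := integrable_rowForm_im_pow w 4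
  have h3 := integrable_rowForm_re_pow (fun j => (1 + Complex.I) * w j) 4
  have h4 := integrable_rowForm_re_pow (fun j => (1 - Complex.I) * w j) 4
  rw [integral_const_mul, integral_add (by fun_prop) (by fun_prop), integral_add h1 h2,
    integral_div, integral_add h3 h4]
  simp_rw [rowForm_im_eq_re, integral_rowForm_re_pow_four, normSqSum_const_mul, Complex.sq_norm,
    Complex.normSq_apply]
  simp
  ring

lemma norm_rowForm_pow_eight_le {n : ℕ} (w : Fin n → ℂ) (g : Fin n → ℝ × ℝ) :
    ‖rowForm w g‖ ^ 8 ≤ 8 * ((rowForm w g).re ^ 8 + (rowForm w g).im ^ 8) := by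
  rw [show (8:ℕ) = 2 * 4 from rfl, pow_mul, Complex.sq_norm, Complex.normSq_apply, pow_mul, pow_mul]
  have := add_pow_le (sq_nonneg (rowForm w g).re) (sq_nonneg (rowForm w g).im) 4
  norm_num at this ⊢
  simpa only [sq] using this

lemma integrable_norm_rowForm_pow_eight {n : ℕ} (w : Fin n → ℂ) :
    Integrable (fun g => ‖rowForm w g‖ ^ 8) (rowLaw n) := by
  refine Integrable.mono' (((integrable_rowForm_re_pow w 8).add
    (integrable_rowForm_im_pow w 8)).const_mul 8)
    ((measurable_rowForm w).norm.pow_const 8).aestronglyMeasurable (.of_forall fun g => ?_)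
  rw [Real.norm_of_nonneg (by positivity)]
  exact norm_rowForm_pow_eight_le w g

lemma integral_norm_rowForm_pow_eight_le {n : ℕ} (w : Fin n → ℂ) :
    ∫ g, ‖rowForm w g‖ ^ 8 ∂(rowLaw n) ≤ 105 * normSqSum w ^ 4 := by
  have h1 := integrable_rowForm_re_pow w 8
  have h2 := integrable_rowForm_im_pow w 8
  refine (integral_mono (integrable_norm_rowForm_pow_eight w) (by fun_prop)
    (norm_rowForm_pow_eight_le w)).trans (le_of_eq ?_)
  rw [integral_const_mul, integral_add h1 h2]
  simp_rw [rowForm_im_eq_re, integral_rowForm_re_pow_eight, normSqSum_const_mul]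
  simp
  ring

/-- The real part of the Hermitian product of two row pairings. -/
noncomputable def rowProd {n : ℕ} (u v : Fin n → ℂ) (g : Fin n → ℝ × ℝ) : ℝ :=
  (rowForm u g * starRingEnd ℂ (rowForm v g)).re

lemma measurable_rowProd {n : ℕ} (u v : Fin n → ℂ) : Measurable (rowProd u v) := by
  have h1 := measurable_rowForm u
  have h2 := measurable_rowForm v
  unfold rowProd
  exact Complex.measurable_re.comp (h1.mul (Complex.continuous_conj.measurable.comp h2))

lemma rowProd_sq {n : ℕ} (u v : Fin n → ℂ) (g : Fin n → ℝ × ℝ) :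
    rowProd u v g ^ 2 =
      3 / 32 * (‖rowForm (fun j => u j + v j) g‖ ^ 4 + ‖rowForm (fun j => u j + -1 * v j) g‖ ^ 4)
      - 1 / 32 * (‖rowForm (fun j => u j + Complex.I * v j) g‖ ^ 4 +
        ‖rowForm (fun j => u j + -Complex.I * v j) g‖ ^ 4)
      - 1 / 8 * (‖rowForm u g‖ ^ 4 + ‖rowForm v g‖ ^ 4) := by
  simp only [rowForm_add, rowForm_const_mul, rowProd]
  generalize rowForm u g = p
  generalize rowForm v g = q
  have h : ∀ z : ℂ, ‖z‖ ^ 4 = (z.re * z.re + z.im * z.im) ^ 2 := fun z => by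
    rw [show (4:ℕ) = 2 * 2 from rfl, pow_mul, Complex.sq_norm, Complex.normSq_apply]
  simp only [h]
  simp
  ring

lemma integrable_rowProd_sq {n : ℕ} (u v : Fin n → ℂ) :
    Integrable (fun g => rowProd u v g ^ 2) (rowLaw n) := by
  simp_rw [rowProd_sq]
  have h := fun w : Fin n → ℂ => integrable_norm_rowForm_pow_four w
  have h1 := h u
  have h2 := h v
  have h3 := h (fun j => u j + v j)
  have h4 := h (fun j => u j + -1 * v j)
  have h5 := h (fun j => u j + Complex.I * v j)
  have h6 := h (fun j => u j + -Complex.I * v j)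
  fun_prop

lemma integral_rowProd_sq {n : ℕ} (u v : Fin n → ℂ) :
    ∫ g, rowProd u v g ^ 2 ∂(rowLaw n) =
      (normSqSum u * normSqSum v + 3 * (∑ j, u j * starRingEnd ℂ (v j)).re ^ 2 -
        (∑ j, u j * starRingEnd ℂ (v j)).im ^ 2) / 2 := by
  simp_rw [rowProd_sq]
  have h := fun w : Fin n → ℂ => integrable_norm_rowForm_pow_four w
  have h1 := h u
  have h2 := h v
  have h3 := h (fun j => u j + v j)
  have h4 := h (fun j => u j + -1 * v j)
  have h5 := h (fun j => u j + Complex.I * v j)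
  have h6 := h (fun j => u j + -Complex.I * v j)
  rw [integral_sub (by fun_prop) (by fun_prop), integral_sub (by fun_prop) (by fun_prop),
    integral_const_mul, integral_const_mul, integral_const_mul, integral_add h1 h2,
    integral_add h3 h4, integral_add h5 h6]
  have hc : ∀ c : ℂ, ∑ j, u j * starRingEnd ℂ (c * v j) =
      starRingEnd ℂ c * ∑ j, u j * starRingEnd ℂ (v j) := fun c => by
    rw [Finset.mul_sum]
    exact Finset.sum_congr rfl fun j _ => by rw [map_mul]; ring
  simp_rw [integral_norm_rowForm_pow_four, normSqSum_add, hc, normSqSum_const_mul]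
  generalize ∑ j, u j * starRingEnd ℂ (v j) = s
  simp
  ring

lemma rowProd_pow_four_le {n : ℕ} (u v : Fin n → ℂ) (g : Fin n → ℝ × ℝ) :
    rowProd u v g ^ 4 ≤ (‖rowForm u g‖ ^ 8 + ‖rowForm v g‖ ^ 8) / 2 := by
  have h : |rowProd u v g| ≤ ‖rowForm u g‖ * ‖rowForm v g‖ := by
    refine (Complex.abs_re_le_norm _).trans ?_
    simp
  calc rowProd u v g ^ 4 = |rowProd u v g| ^ 4 := (Even.pow_abs (by decide) _).symm
    _ ≤ (‖rowForm u g‖ * ‖rowForm v g‖) ^ 4 := by gcongr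
    _ ≤ _ := by nlinarith [sq_nonneg (‖rowForm u g‖ ^ 4 - ‖rowForm v g‖ ^ 4)]

lemma integrable_rowProd_pow_four {n : ℕ} (u v : Fin n → ℂ) :
    Integrable (fun g => rowProd u v g ^ 4) (rowLaw n) := by
  refine Integrable.mono' (((integrable_norm_rowForm_pow_eight u).add
    (integrable_norm_rowForm_pow_eight v)).div_const 2)
    ((measurable_rowProd u v).pow_const 4).aestronglyMeasurable (.of_forall fun g => ?_)
  rw [Real.norm_of_nonneg (by positivity)]
  exact rowProd_pow_four_le u v g

lemma integral_rowProd_pow_four_le {n : ℕ} (u v : Fin n → ℂ) :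
    ∫ g, rowProd u v g ^ 4 ∂(rowLaw n) ≤ 105 / 2 * (normSqSum u ^ 4 + normSqSum v ^ 4) := by
  have h1 := integrable_norm_rowForm_pow_eight u
  have h2 := integrable_norm_rowForm_pow_eight v
  refine (integral_mono (integrable_rowProd_pow_four u v) (by fun_prop)
    (rowProd_pow_four_le u v)).trans ?_
  rw [integral_div, integral_add h1 h2]
  linarith [integral_norm_rowForm_pow_eight_le u, integral_norm_rowForm_pow_eight_le v]

lemma integral_exp_sq_gaussianReal : ∫ x, rexp (x ^ 2 / 4) ∂(gaussianReal 0 1) = √2 := by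
  rw [integral_gaussianReal_eq_integral_smul one_ne_zero]
  have h1 : ∀ x : ℝ, gaussianPDFReal 0 1 x • rexp (x ^ 2 / 4) =
      (√(2 * π))⁻¹ * rexp (-(1/4) * x ^ 2) := by
    intro x
    simp only [gaussianPDFReal, smul_eq_mul, NNReal.coe_one, mul_one, sub_zero]
    rw [mul_assoc, ← Real.exp_add]
    ring_nf
  simp_rw [h1]
  rw [integral_const_mul, integral_gaussian, show π / (1 / 4) = 2 * (2 * π) by ring,
    Real.sqrt_mul (by norm_num) (2 * π)]
  have : √(2 * π) ≠ 0 := by positivity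
  rw [mul_left_comm, inv_mul_cancel₀ this, mul_one]

lemma integral_exp_rowForm_re_sq {n : ℕ} {w : Fin n → ℂ} (hw : 0 < normSqSum w) :
    Integrable (fun g => rexp ((rowForm w g).re ^ 2 / (2 * normSqSum w))) (rowLaw n) ∧
    ∫ g, rexp ((rowForm w g).re ^ 2 / (2 * normSqSum w)) ∂(rowLaw n) = √2 := by
  have hmeas : Measurable fun g => (rowForm w g).re :=
    Complex.measurable_re.comp (measurable_rowForm w)
  have key : ∫ g, rexp ((rowForm w g).re ^ 2 / (2 * normSqSum w)) ∂(rowLaw n) = √2 := by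
    rw [← integral_map (f := fun x : ℝ => rexp (x ^ 2 / (2 * normSqSum w))) hmeas.aemeasurable
      (by fun_prop), map_rowForm_re, gaussianReal_eq_map_sqrt (by positivity),
      integral_map (by fun_prop) (by fun_prop), ← integral_exp_sq_gaussianReal]
    congr 1
    ext x
    rw [mul_pow, Real.sq_sqrt (by positivity)]
    congr 1
    field_simp
    ring
  exact ⟨Integrable.of_integral_ne_zero (by rw [key]; positivity), key⟩

lemma integral_exp_norm_rowForm_sq {n : ℕ} {w : Fin n → ℂ} (hw : 0 < normSqSum w) :
    Integrable (fun g => rexp (‖rowForm w g‖ ^ 2 / (4 * normSqSum w))) (rowLaw n) ∧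
    ∫ g, rexp (‖rowForm w g‖ ^ 2 / (4 * normSqSum w)) ∂(rowLaw n) ≤ √2 := by
  have hn : normSqSum (fun j => -Complex.I * w j) = normSqSum w := by
    rw [normSqSum_const_mul]; simp
  obtain ⟨i1, e1⟩ := integral_exp_rowForm_re_sq hw
  obtain ⟨i2, e2⟩ := integral_exp_rowForm_re_sq (w := fun j => -Complex.I * w j) (hn ▸ hw)
  rw [hn] at i2 e2
  simp_rw [← rowForm_im_eq_re] at i2 e2
  have hle : ∀ g, rexp (‖rowForm w g‖ ^ 2 / (4 * normSqSum w)) ≤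
      (rexp ((rowForm w g).re ^ 2 / (2 * normSqSum w)) +
        rexp ((rowForm w g).im ^ 2 / (2 * normSqSum w))) / 2 := by
    intro g
    have : ‖rowForm w g‖ ^ 2 / (4 * normSqSum w) = (rowForm w g).re ^ 2 / (2 * normSqSum w) / 2 +
        (rowForm w g).im ^ 2 / (2 * normSqSum w) / 2 := by
      rw [Complex.sq_norm, Complex.normSq_apply]
      field_simp
      ring
    rw [this, Real.exp_add]
    have ha := Real.exp_add ((rowForm w g).re ^ 2 / (2 * normSqSum w) / 2)
      ((rowForm w g).re ^ 2 / (2 * normSqSum w) / 2)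
    have hb := Real.exp_add ((rowForm w g).im ^ 2 / (2 * normSqSum w) / 2)
      ((rowForm w g).im ^ 2 / (2 * normSqSum w) / 2)
    rw [add_halves] at ha hb
    rw [ha, hb]
    nlinarith [sq_nonneg (rexp ((rowForm w g).re ^ 2 / (2 * normSqSum w) / 2) -
      rexp ((rowForm w g).im ^ 2 / (2 * normSqSum w) / 2))]
  have hi : Integrable (fun g => (rexp ((rowForm w g).re ^ 2 / (2 * normSqSum w)) +
        rexp ((rowForm w g).im ^ 2 / (2 * normSqSum w))) / 2) (rowLaw n) := (i1.add i2).div_const 2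
  have hI : Integrable (fun g => rexp (‖rowForm w g‖ ^ 2 / (4 * normSqSum w))) (rowLaw n) := by
    have := measurable_rowForm w
    refine hi.mono' (by fun_prop) (.of_forall fun g => ?_)
    rw [Real.norm_of_nonneg (by positivity)]
    exact hle g
  refine ⟨hI, (integral_mono hI hi hle).trans (le_of_eq ?_)⟩
  rw [integral_div, integral_add i1 i2, e1, e2]
  ring

lemma measure_sum_nonneg_le_exp {Ω : Type*} [MeasurableSpace Ω] {ν : Measure Ω}
    [IsProbabilityMeasure ν] {f : Ω → ℝ} {c : ℝ} (hf : Integrable (fun ω => rexp (f ω)) ν)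
    (hc : ∫ ω, rexp (f ω) ∂ν ≤ rexp (-c)) (m : ℕ) :
    (Measure.pi fun _ : Fin m => ν) {g | 0 ≤ ∑ i, f (g i)} ≤ ENNReal.ofReal (rexp (-(c * m))) := by
  have h := mul_meas_ge_le_integral_of_nonneg (μ := Measure.pi fun _ : Fin m => ν)
    (f := fun g => ∏ i, rexp (f (g i))) (.of_forall fun g => by simp only [Pi.zero_apply]; positivity)
    (Integrable.fintype_prod (fun _ => hf)) 1
  rw [integral_fintype_prod_eq_pow (fun ω => rexp (f ω)), one_mul, Fintype.card_fin] at h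
  have hset : {g : Fin m → Ω | 1 ≤ ∏ i, rexp (f (g i))} = {g | 0 ≤ ∑ i, f (g i)} := by
    ext g
    simp [← Real.exp_sum]
  rw [hset] at h
  rw [← ofReal_measureReal]
  refine ENNReal.ofReal_le_ofReal (h.trans ?_)
  calc (∫ ω, rexp (f ω) ∂ν) ^ m ≤ rexp (-c) ^ m := by
        gcongr
    _ = rexp (-(c * m)) := by rw [← Real.exp_nat_mul]; ring_nf

lemma measure_sum_norm_rowForm_sq_gt_le {n : ℕ} (w : Fin n → ℂ) (m : ℕ) :
    (Measure.pi fun _ : Fin m => rowLaw n)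
      {g | 8 * m * normSqSum w < ∑ i, ‖rowForm w (g i)‖ ^ 2} ≤ ENNReal.ofReal (rexp (-m)) := by
  rcases (normSqSum_nonneg w).eq_or_lt with hw | hw
  · have hz : ∀ j, w j = 0 := fun j => by
      have := (Finset.sum_eq_zero_iff_of_nonneg (fun j _ => by positivity)).1 hw.symm j
        (Finset.mem_univ j)
      simpa using this
    have : {g : Fin m → Fin n → ℝ × ℝ |
        8 * m * normSqSum w < ∑ i, ‖rowForm w (g i)‖ ^ 2} = ∅ := by
      ext g
      simp [← hw, rowForm, hz]
    rw [this]
    simp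
  obtain ⟨hI, he⟩ := integral_exp_norm_rowForm_sq hw
  have hI' : Integrable (fun g => rexp (‖rowForm w g‖ ^ 2 / (4 * normSqSum w) - 2))
      (rowLaw n) := by
    simp_rw [Real.exp_sub]
    exact hI.div_const _
  have hc : ∫ g, rexp (‖rowForm w g‖ ^ 2 / (4 * normSqSum w) - 2) ∂(rowLaw n) ≤ rexp (-1) := by
    simp_rw [Real.exp_sub]
    rw [integral_div, div_le_iff₀ (by positivity), ← Real.exp_add]
    norm_num
    refine he.trans ?_
    have h1 : (2:ℝ) ≤ rexp 1 := by have := Real.add_one_le_exp 1; linarith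
    have h2 : √2 ≤ 2 := Real.sqrt_le_iff.2 ⟨by norm_num, by norm_num⟩
    linarith
  refine (measure_mono fun g hg => ?_).trans ((measure_sum_nonneg_le_exp hI' hc m).trans
    (by rw [one_mul]))
  simp only [Set.mem_ofPred_eq] at hg ⊢
  rw [Finset.sum_sub_distrib, ← Finset.sum_div]
  have : (2:ℝ) * m ≤ (∑ i, ‖rowForm w (g i)‖ ^ 2) / (4 * normSqSum w) := by
    rw [le_div_iff₀ (by positivity)]
    linarith
  simp
  linarith

lemma exp_neg_le_of_nonneg {x : ℝ} (hx : 0 ≤ x) : rexp (-x) ≤ 1 - x ^ 2 / 2 + x ^ 4 / 2 := by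
  rcases le_total x 1 with h | h
  · have h1 : rexp (-x) ≤ 1 - x / 2 := by
      have h2 : rexp (-x) * (1 + x) ≤ 1 := by
        calc rexp (-x) * (1 + x) ≤ rexp (-x) * rexp x := by
              gcongr; linarith [Real.add_one_le_exp x]
          _ = 1 := by rw [← Real.exp_add]; simp
      nlinarith [Real.exp_pos (-x)]
    nlinarith [pow_nonneg hx 4]
  · have h1 : rexp (-x) ≤ 1 := Real.exp_le_one_iff.2 (by linarith)
    nlinarith [mul_nonneg (sq_nonneg x) (by nlinarith : 0 ≤ x ^ 2 - 1)]

lemma measure_sum_abs_rowProd_le {n : ℕ} {u v : Fin n → ℂ}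
    (hlow : 1 / 2 ≤ normSqSum u * normSqSum v - (∑ j, u j * starRingEnd ℂ (v j)).im ^ 2)
    (hu : normSqSum u ^ 4 ≤ 2) (hv : normSqSum v ^ 4 ≤ 2) (m : ℕ) :
    (Measure.pi fun _ : Fin m => rowLaw n) {g | ∑ i, |rowProd u v (g i)| ≤ m / 2 ^ 11} ≤
      ENNReal.ofReal (rexp (-(m / 2 ^ 17))) := by
  have h2 := integral_rowProd_sq u v
  have h4 := integral_rowProd_pow_four_le u v
  have i2 := integrable_rowProd_sq u v
  have i4 := integrable_rowProd_pow_four u v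
  have hle : ∀ g, rexp (-(|rowProd u v g| / 64)) ≤
      1 - 1 / 2 ^ 13 * rowProd u v g ^ 2 + 1 / 2 ^ 25 * rowProd u v g ^ 4 := by
    intro g
    refine (exp_neg_le_of_nonneg (by positivity)).trans (le_of_eq ?_)
    rw [div_pow, div_pow, sq_abs, Even.pow_abs (by decide)]
    ring
  have hm := measurable_rowProd u v
  have hi : Integrable (fun g => 1 - 1 / 2 ^ 13 * rowProd u v g ^ 2 +
      1 / 2 ^ 25 * rowProd u v g ^ 4) (rowLaw n) := by fun_prop
  have hI : Integrable (fun g => rexp (-(|rowProd u v g| / 64))) (rowLaw n) := by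
    refine hi.mono' (by fun_prop) (.of_forall fun g => ?_)
    rw [Real.norm_of_nonneg (by positivity)]
    exact hle g
  have hE : ∫ g, rexp (-(|rowProd u v g| / 64)) ∂(rowLaw n) ≤ rexp (-(1 / 2 ^ 16)) := by
    refine (integral_mono hI hi hle).trans ?_
    rw [integral_add (by fun_prop) (by fun_prop), integral_sub (by fun_prop) (by fun_prop),
      integral_const_mul, integral_const_mul, h2]
    simp only [integral_const, probReal_univ, smul_eq_mul, mul_one]
    have := Real.add_one_le_exp (-(1 / 2 ^ 16 : ℝ))
    nlinarith [sq_nonneg (∑ j, u j * starRingEnd ℂ (v j)).re]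
  have hI' : Integrable (fun g => rexp (1 / 2 ^ 17 - |rowProd u v g| / 64)) (rowLaw n) := by
    simp_rw [sub_eq_add_neg, Real.exp_add]
    exact hI.const_mul _
  have hc : ∫ g, rexp (1 / 2 ^ 17 - |rowProd u v g| / 64) ∂(rowLaw n) ≤ rexp (-(1 / 2 ^ 17)) := by
    simp_rw [sub_eq_add_neg, Real.exp_add]
    rw [integral_const_mul]
    refine (mul_le_mul_of_nonneg_left hE (by positivity)).trans (le_of_eq ?_)
    rw [← Real.exp_add]
    norm_num
  refine (measure_mono fun g hg => ?_).trans ((measure_sum_nonneg_le_exp hI' hc m).trans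
    (by rw [one_div_mul_eq_div]))
  simp only [Set.mem_ofPred_eq] at hg ⊢
  rw [Finset.sum_sub_distrib, Finset.sum_const, ← Finset.sum_div, Finset.card_univ,
    Fintype.card_fin, nsmul_eq_mul]
  linarith

lemma sum_mul_sq_add_sub {ι : Type*} [Fintype ι] {c f : ι → ℝ} (hc : ∑ i, c i = 1) (s : ℝ) :
    ∑ i, c i * (s + f i - ∑ l, c l * f l) ^ 2 =
      s ^ 2 + ∑ i, c i * f i ^ 2 - (∑ l, c l * f l) ^ 2 := by
  set y := ∑ l, c l * f l with hy
  have : ∀ i, c i * (s + f i - y) ^ 2 =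
      (s - y) ^ 2 * c i + 2 * (s - y) * (c i * f i) + c i * f i ^ 2 := fun i => by ring
  simp_rw [this]
  rw [Finset.sum_add_distrib, Finset.sum_add_distrib, ← Finset.mul_sum, ← Finset.mul_sum, hc, ← hy]
  ring

lemma sum_mul_normSqSum_add_sub_le {ι κ : Type*} [Fintype ι] [Fintype κ] {c : ι → ℝ}
    (hc : ∑ i, c i = 1) (F : ι → κ → ℂ) (S : κ → ℂ) :
    ∑ i, c i * normSqSum (fun a => S a + F i a - ∑ l, (c l : ℂ) * F l a) ≤
      normSqSum S + ∑ i, c i * normSqSum (F i) := by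
  simp only [normSqSum, Finset.mul_sum]
  rw [Finset.sum_comm, Finset.sum_comm (f := fun i a => c i * ‖F i a‖ ^ 2),
    ← Finset.sum_add_distrib]
  refine Finset.sum_le_sum fun a _ => ?_
  have h1 := sum_mul_sq_add_sub hc (f := fun i => (F i a).re) (S a).re
  have h2 := sum_mul_sq_add_sub hc (f := fun i => (F i a).im) (S a).im
  have hre : (∑ l, (c l : ℂ) * F l a).re = ∑ l, c l * (F l a).re := by simp
  have him : (∑ l, (c l : ℂ) * F l a).im = ∑ l, c l * (F l a).im := by simp
  have e1 : ∀ i, c i * ‖S a + F i a - ∑ l, (c l : ℂ) * F l a‖ ^ 2 =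
      c i * ((S a).re + (F i a).re - ∑ l, c l * (F l a).re) ^ 2 +
      c i * ((S a).im + (F i a).im - ∑ l, c l * (F l a).im) ^ 2 := fun i => by
    rw [Complex.sq_norm, Complex.normSq_apply, Complex.sub_re, Complex.sub_im, hre, him,
      Complex.add_re, Complex.add_im]
    ring
  have e2 : ∀ i, c i * ‖F i a‖ ^ 2 = c i * (F i a).re ^ 2 + c i * (F i a).im ^ 2 := fun i => by
    rw [Complex.sq_norm, Complex.normSq_apply]
    ring
  simp_rw [e1, e2]
  rw [Finset.sum_add_distrib, Finset.sum_add_distrib, h1, h2, Complex.sq_norm,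
    Complex.normSq_apply]
  nlinarith [sq_nonneg (∑ l, c l * (F l a).re), sq_nonneg (∑ l, c l * (F l a).im)]

/-- Maurey's empirical approximation of a convex combination. -/
lemma exists_multiset_normSqSum_le {ι κ : Type*} [Fintype ι] [Fintype κ] {c : ι → ℝ}
    (hc0 : ∀ i, 0 ≤ c i) (hc : ∑ i, c i = 1) {F : ι → κ → ℂ} {B : ℝ}
    (hB : ∀ i, normSqSum (F i) ≤ B) (N : ℕ) :
    ∃ s : Multiset ι, s.card = N ∧
      normSqSum (fun a => (s.map fun i => F i a).sum - N * ∑ l, (c l : ℂ) * F l a) ≤ N * B := by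
  induction N with
  | zero => exact ⟨0, by simp, by simp [normSqSum]⟩
  | succ N ih =>
    obtain ⟨s, hs, hS⟩ := ih
    set S : κ → ℂ := fun a => (s.map fun i => F i a).sum - N * ∑ l, (c l : ℂ) * F l a with hSdef
    obtain ⟨i, hi⟩ : ∃ i, normSqSum (fun a => S a + F i a - ∑ l, (c l : ℂ) * F l a) ≤
        normSqSum S + B := by
      by_contra! hcon
      have h1 := sum_mul_normSqSum_add_sub_le hc F S
      have h2 : ∑ i, c i * normSqSum (F i) ≤ B := by
        calc ∑ i, c i * normSqSum (F i) ≤ ∑ i, c i * B :=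
              Finset.sum_le_sum fun i _ => mul_le_mul_of_nonneg_left (hB i) (hc0 i)
          _ = B := by rw [← Finset.sum_mul, hc, one_mul]
      obtain ⟨i₀, hi₀⟩ : ∃ i, 0 < c i := by
        by_contra! h
        have := Finset.sum_nonpos fun i (_ : i ∈ Finset.univ) => h i
        linarith
      have h3 : ∑ i, c i * (normSqSum S + B) <
          ∑ i, c i * normSqSum (fun a => S a + F i a - ∑ l, (c l : ℂ) * F l a) :=
        Finset.sum_lt_sum (fun i _ => mul_le_mul_of_nonneg_left (hcon i).le (hc0 i))
          ⟨i₀, Finset.mem_univ _, mul_lt_mul_of_pos_left (hcon i₀) hi₀⟩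
      rw [← Finset.sum_mul, hc] at h3
      linarith
    refine ⟨i ::ₘ s, by simp [hs], ?_⟩
    have : (fun a => ((i ::ₘ s).map fun i => F i a).sum -
        ((N + 1 : ℕ) : ℂ) * ∑ l, (c l : ℂ) * F l a) =
        fun a => S a + F i a - ∑ l, (c l : ℂ) * F l a := by
      ext a
      simp only [Multiset.map_cons, Multiset.sum_cons, hSdef]
      push_cast
      ring
    rw [this]
    push_cast
    linarith

/-- The vectors `D i^t e_j`. -/
noncomputable def cornerVec {n : ℕ} (D : ℝ) (i : Fin n × Fin 4) : Fin n → ℂ :=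
  Pi.single i.1 ((D : ℂ) * Complex.I ^ (i.2 : ℕ))

/-- The average of a multiset of `N` vectors `D i^t e_j`. -/
noncomputable def netPoint {n N : ℕ} (D : ℝ) (s : Sym (Fin n × Fin 4) N) : Fin n → ℂ :=
  (N : ℂ)⁻¹ • ((s : Multiset (Fin n × Fin 4)).map (cornerVec D)).sum

lemma normSqSum_cornerVec {n : ℕ} (D : ℝ) (i : Fin n × Fin 4) :
    normSqSum (cornerVec D i) = D ^ 2 := by
  unfold normSqSum cornerVec
  rw [Finset.sum_eq_single i.1]
  · simp
  · intro j _ hj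
    simp [hj]
  · simp

lemma netPoint_replicate {n N : ℕ} (hN : 0 < N) (D : ℝ) (i : Fin n × Fin 4) :
    netPoint D (Sym.replicate N i) = cornerVec D i := by
  have : (N : ℂ) ≠ 0 := by exact_mod_cast hN.ne'
  simp only [netPoint, Sym.coe_replicate, Multiset.map_replicate, Multiset.sum_replicate]
  rw [← Nat.cast_smul_eq_nsmul ℂ, inv_smul_smul₀ this]

lemma exists_weights_cornerVec {n : ℕ} (hn : 0 < n) {D : ℝ} (hD : 0 < D) {w : Fin n → ℂ}
    (hw : 2 * ∑ j, ‖w j‖ ≤ D) :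
    ∃ c : Fin n × Fin 4 → ℝ, (∀ i, 0 ≤ c i) ∧ ∑ i, c i = 1 ∧
      w = ∑ i, (c i : ℂ) • cornerVec D i := by
  have hn' : (0:ℝ) < n := by exact_mod_cast hn
  refine ⟨fun i => ‖w i.1‖ / (2 * D) + (1 - 2 * (∑ j, ‖w j‖) / D) / (4 * n) +
    (w i.1 * starRingEnd ℂ (Complex.I ^ (i.2 : ℕ))).re / (2 * D), fun i => ?_, ?_, ?_⟩
  · have h1 : -‖w i.1‖ ≤ (w i.1 * starRingEnd ℂ (Complex.I ^ (i.2 : ℕ))).re := by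
      have := Complex.abs_re_le_norm (w i.1 * starRingEnd ℂ (Complex.I ^ (i.2 : ℕ)))
      rw [norm_mul, RCLike.norm_conj, norm_pow, Complex.norm_I, one_pow, mul_one] at this
      exact (abs_le.1 this).1
    have h2 : 0 ≤ (1 - 2 * (∑ j, ‖w j‖) / D) / (4 * n) := by
      have : 2 * (∑ j, ‖w j‖) / D ≤ 1 := (div_le_one hD).2 hw
      have : 0 ≤ 1 - 2 * (∑ j, ‖w j‖) / D := by linarith
      positivity
    have h3 : 0 ≤ (‖w i.1‖ + (w i.1 * starRingEnd ℂ (Complex.I ^ (i.2 : ℕ))).re) / (2 * D) := by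
      have : 0 ≤ ‖w i.1‖ + (w i.1 * starRingEnd ℂ (Complex.I ^ (i.2 : ℕ))).re := by linarith
      positivity
    rw [add_div] at h3
    simp only
    linarith
  · rw [Fintype.sum_prod_type]
    have : ∀ j : Fin n, ∑ t : Fin 4, (‖w j‖ / (2 * D) + (1 - 2 * (∑ j, ‖w j‖) / D) / (4 * n) +
        (w j * starRingEnd ℂ (Complex.I ^ (t : ℕ))).re / (2 * D)) =
        2 * ‖w j‖ / D + (1 - 2 * (∑ j, ‖w j‖) / D) / n := by
      intro j
      rw [Fin.sum_univ_four]
      simp [pow_succ]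
      field_simp
      ring
    simp_rw [this]
    rw [Finset.sum_add_distrib, ← Finset.sum_div, ← Finset.mul_sum]
    simp
    field_simp
    ring
  · ext a
    rw [Finset.sum_apply, Fintype.sum_prod_type, Finset.sum_eq_single a]
    · have hD' : (D : ℂ) ≠ 0 := by exact_mod_cast hD.ne'
      rw [Fin.sum_univ_four]
      simp [cornerVec, pow_succ]
      conv_lhs => rw [← Complex.re_add_im (w a)]
      field_simp
      ring
    · intro b _ hb
      simp [cornerVec, hb.symm]
    · simp

lemma exists_netPoint_approx {n m N : ℕ} (hn : 0 < n) (hm : 0 < m) (hN : 0 < N) {D B : ℝ}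
    (hD : 0 < D) (L : Fin m → (Fin n → ℂ) →ₗ[ℂ] ℂ)
    (hB : ∀ i, normSqSum (cornerVec D i) + (∑ r, ‖L r (cornerVec D i)‖ ^ 2) / m ≤ B)
    {w : Fin n → ℂ} (hw : 2 * ∑ j, ‖w j‖ ≤ D) :
    ∃ s : Sym (Fin n × Fin 4) N, normSqSum (w - netPoint D s) ≤ B / N ∧
      ∑ r, ‖L r (w - netPoint D s)‖ ^ 2 ≤ m * (B / N) := by
  obtain ⟨c, hc0, hc, hwc⟩ := exists_weights_cornerVec hn hD hw
  have hm' : (0:ℝ) < m := by exact_mod_cast hm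
  have hN' : (0:ℝ) < N := by exact_mod_cast hN
  have hNc : (N : ℂ) ≠ 0 := by exact_mod_cast hN.ne'
  have hsplit : ∀ (f : Fin n → ℂ) (h : Fin m → ℂ),
      normSqSum (Sum.elim f fun r => (√m : ℂ)⁻¹ * h r) =
        normSqSum f + (∑ r, ‖h r‖ ^ 2) / m := by
    intro f h
    simp only [normSqSum, Fintype.sum_sum_type, Sum.elim_inl, Sum.elim_inr, norm_mul, mul_pow,
      ← Finset.mul_sum, norm_inv, Complex.norm_real, Real.norm_of_nonneg (Real.sqrt_nonneg _),
      inv_pow, Real.sq_sqrt hm'.le]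
    rw [inv_mul_eq_div]
  obtain ⟨s, hs, hS⟩ := exists_multiset_normSqSum_le hc0 hc
    (F := fun i => Sum.elim (cornerVec D i) fun r => (√m : ℂ)⁻¹ * L r (cornerVec D i))
    (B := B) (fun i => by rw [hsplit]; exact hB i) N
  refine ⟨⟨s, hs⟩, ?_⟩
  set p := netPoint D (⟨s, hs⟩ : Sym (Fin n × Fin 4) N) with hp
  have hsum : (s.map (cornerVec D)).sum = (N : ℂ) • p := by
    have : p = (N : ℂ)⁻¹ • (s.map (cornerVec D)).sum := rfl
    rw [this, smul_inv_smul₀ hNc]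
  have key : (fun a => (s.map fun i => (Sum.elim (cornerVec D i)
        fun r => (√m : ℂ)⁻¹ * L r (cornerVec D i) : Fin n ⊕ Fin m → ℂ) a).sum -
      N * ∑ l, (c l : ℂ) * (Sum.elim (cornerVec D l)
        fun r => (√m : ℂ)⁻¹ * L r (cornerVec D l) : Fin n ⊕ Fin m → ℂ) a) =
      fun a => (-N : ℂ) * Sum.elim (w - p) (fun r => (√m : ℂ)⁻¹ * L r (w - p)) a := by
    ext a
    rcases a with a | r
    · have h1 : (s.map fun i => cornerVec D i a).sum = N * p a := by
        have := congrArg (Pi.evalAddMonoidHom (fun _ : Fin n => ℂ) a) hsum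
        rw [map_multiset_sum, Multiset.map_map] at this
        simpa using this
      have h2 : ∑ l, (c l : ℂ) * cornerVec D l a = w a := by
        rw [hwc]; simp
      simp only [Sum.elim_inl, h1, h2, Pi.sub_apply]
      ring
    · have h1 : (s.map fun i => L r (cornerVec D i)).sum = N * L r p := by
        have := congrArg (L r) hsum
        rw [map_multiset_sum, Multiset.map_map, map_smul] at this
        simpa using this
      have h2 : ∑ l, (c l : ℂ) * L r (cornerVec D l) = L r w := by
        conv_rhs => rw [hwc]
        simp
      simp only [Sum.elim_inr, Multiset.sum_map_mul_left, h1, map_sub, mul_left_comm _ (√m : ℂ)⁻¹,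
        ← Finset.mul_sum, h2]
      ring
  rw [key, normSqSum_const_mul, hsplit, norm_neg, Complex.norm_natCast] at hS
  have hfin : normSqSum (w - p) + (∑ r, ‖L r (w - p)‖ ^ 2) / m ≤ B / N := by
    rw [le_div_iff₀ hN']
    have : (N:ℝ) * ((normSqSum (w - p) + (∑ r, ‖L r (w - p)‖ ^ 2) / m) * N) ≤ N * B := by
      linarith
    exact le_of_mul_le_mul_left this hN'
  have h1 := normSqSum_nonneg (w - p)
  have h2 : 0 ≤ ∑ r, ‖L r (w - p)‖ ^ 2 := Finset.sum_nonneg fun _ _ => by positivity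
  have h3 : 0 ≤ (∑ r, ‖L r (w - p)‖ ^ 2) / m := by positivity
  refine ⟨by linarith, ?_⟩
  rw [mul_comm, ← div_le_iff₀ hm']
  linarith

lemma card_sym_le_exp {k n M : ℕ} (hk : 0 < k) (hkn : k ≤ n) (hM : 4 ≤ M) :
    (Fintype.card (Sym (Fin n × Fin 4) (M * k)) : ℝ) ≤
      rexp (2 * M * (k * Real.log (rexp 1 * n / k))) := by
  have hn : 0 < n := hk.trans_le hkn
  have hk' : (0:ℝ) < k := by exact_mod_cast hk
  have hn' : (0:ℝ) < n := by exact_mod_cast hn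
  have hkn' : (k:ℝ) ≤ n := by exact_mod_cast hkn
  have hM' : (4:ℝ) ≤ M := by exact_mod_cast hM
  set N := M * k with hN
  have hNpos : 0 < N := by positivity
  have hN' : (0:ℝ) < N := by exact_mod_cast hNpos
  have hl : Real.log (rexp 1 * n / k) = 1 + Real.log (n / k) := by
    rw [mul_div_assoc, Real.log_mul (by positivity) (by positivity), Real.log_exp]
  have hl0 : 0 ≤ Real.log ((n:ℝ) / k) := Real.log_nonneg ((one_le_div hk').2 hkn')
  rw [Sym.card_sym_eq_choose]
  simp only [Fintype.card_prod, Fintype.card_fin]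
  have h1 : (((n * 4 + N - 1).choose N : ℕ) : ℝ) ≤ ((4 * n + N : ℝ)) ^ N / N.factorial := by
    refine (Nat.choose_le_pow_div _ _).trans ?_
    gcongr
    have : n * 4 + N - 1 ≤ 4 * n + N := by omega
    exact_mod_cast this
  have h2 : ((N:ℝ)) ^ N / N.factorial ≤ rexp N := Real.pow_div_factorial_le_exp _ hN'.le N
  have h3 : (4 * n + N : ℝ) ≤ N * (rexp 1 * (n / k)) := by
    have he : (2:ℝ) ≤ rexp 1 := by have := Real.add_one_le_exp 1; linarith
    have h4 : (N:ℝ) = M * k := by rw [hN]; push_cast; ring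
    have h5 : N * (rexp 1 * (n / k)) = M * n * rexp 1 := by rw [h4]; field_simp
    rw [h5, h4]
    nlinarith [mul_le_mul_of_nonneg_left he (by positivity : (0:ℝ) ≤ M * n),
      mul_le_mul_of_nonneg_left hkn' (by positivity : (0:ℝ) ≤ M),
      mul_le_mul_of_nonneg_right hM' hn'.le]
  calc (((n * 4 + N - 1).choose N : ℕ) : ℝ) ≤ ((4 * n + N : ℝ)) ^ N / N.factorial := h1
    _ ≤ (N * (rexp 1 * (n / k))) ^ N / N.factorial := by gcongr
    _ = (N:ℝ) ^ N / N.factorial * (rexp 1 * (n / k)) ^ N := by rw [mul_pow]; ring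
    _ ≤ rexp N * (rexp 1 * (n / k)) ^ N := by gcongr
    _ = rexp (N * (2 + Real.log (n / k))) := by
        have : rexp 1 * ((n:ℝ) / k) = rexp (1 + Real.log (n / k)) := by
          rw [Real.exp_add, Real.exp_log (by positivity)]
        rw [this, ← Real.exp_nat_mul, ← Real.exp_add]
        ring_nf
    _ ≤ _ := by
        rw [Real.exp_le_exp, hl, hN]
        push_cast
        have : 0 ≤ (M:ℝ) * k := by positivity
        nlinarith [mul_nonneg this hl0]

/-- The pairing `rowForm` as a linear map in the vector. -/
noncomputable def rowLin {n : ℕ} (g : Fin n → ℝ × ℝ) : (Fin n → ℂ) →ₗ[ℂ] ℂ where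
  toFun w := rowForm w g
  map_add' u v := rowForm_add u v g
  map_smul' c w := rowForm_const_mul c w g

lemma rowLin_apply {n : ℕ} (g : Fin n → ℝ × ℝ) (w : Fin n → ℂ) : rowLin g w = rowForm w g := rfl

lemma norm_sum_mul_conj_sq_le {ι : Type*} [Fintype ι] (u v : ι → ℂ) :
    ‖∑ j, u j * starRingEnd ℂ (v j)‖ ^ 2 ≤ normSqSum u * normSqSum v := by
  have h : ‖∑ j, u j * starRingEnd ℂ (v j)‖ ≤ ∑ j, ‖u j‖ * ‖v j‖ :=
    (norm_sum_le _ _).trans_eq (by simp)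
  calc ‖∑ j, u j * starRingEnd ℂ (v j)‖ ^ 2 ≤ (∑ j, ‖u j‖ * ‖v j‖) ^ 2 := by gcongr
    _ ≤ _ := Finset.sum_mul_sq_le_sq_mul_sq _ _ _

lemma norm_sum_mul_conj_le {ι : Type*} [Fintype ι] {u v : ι → ℂ} {a b : ℝ} (ha : 0 ≤ a)
    (hb : 0 ≤ b) (hu : normSqSum u ≤ a ^ 2) (hv : normSqSum v ≤ b ^ 2) :
    ‖∑ j, u j * starRingEnd ℂ (v j)‖ ≤ a * b := by
  refine abs_le_of_sq_le_sq' ?_ (by positivity) |>.2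
  rw [mul_pow]
  exact (norm_sum_mul_conj_sq_le u v).trans
    (mul_le_mul hu hv (normSqSum_nonneg v) (by positivity))

lemma abs_normSqSum_sub_sub_one_le {ι : Type*} [Fintype ι] {u p : ι → ℂ} {ε : ℝ} (hε : 0 ≤ ε)
    (hε1 : ε ≤ 1) (hu : normSqSum u = 1) (h : normSqSum (u - p) ≤ ε ^ 2) :
    |normSqSum p - 1| ≤ 3 * ε := by
  have e : p = fun j => u j + -1 * (u - p) j := by ext j; simp
  have h1 := normSqSum_add u (fun j => -1 * (u - p) j)
  rw [← e, normSqSum_const_mul, hu] at h1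
  have h2 := norm_sum_mul_conj_le (u := u) (v := u - p) zero_le_one hε (by simp [hu]) h
  have h3 : (∑ j, u j * starRingEnd ℂ (-1 * (u - p) j)).re =
      -(∑ j, u j * starRingEnd ℂ ((u - p) j)).re := by
    simp only [neg_one_mul, map_neg, mul_neg, Finset.sum_neg_distrib, Complex.neg_re]
  have h4 := abs_le.1 ((Complex.abs_re_le_norm _).trans h2)
  have h5 := normSqSum_nonneg (u - p)
  rw [h3] at h1
  simp only [norm_neg, norm_one] at h1
  rw [abs_le]
  constructor <;> nlinarith

lemma abs_im_sum_mul_conj_le {ι : Type*} [Fintype ι] {u v p q : ι → ℂ} {ε : ℝ} (hε : 0 ≤ ε)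
    (hv : normSqSum v = 1) (huv : (∑ j, u j * starRingEnd ℂ (v j)).im = 0)
    (hp : normSqSum p ≤ 2 ^ 2)
    (hup : normSqSum (u - p) ≤ ε ^ 2) (hvq : normSqSum (v - q) ≤ ε ^ 2) :
    |(∑ j, p j * starRingEnd ℂ (q j)).im| ≤ 3 * ε := by
  have e : ∑ j, p j * starRingEnd ℂ (q j) = ∑ j, u j * starRingEnd ℂ (v j) -
      ∑ j, (u - p) j * starRingEnd ℂ (v j) - ∑ j, p j * starRingEnd ℂ ((v - q) j) := by
    rw [← Finset.sum_sub_distrib, ← Finset.sum_sub_distrib]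
    refine Finset.sum_congr rfl fun j _ => ?_
    simp only [Pi.sub_apply, map_sub]
    ring
  have h1 := norm_sum_mul_conj_le (u := u - p) (v := v) hε zero_le_one hup (by simp [hv])
  have h2 := norm_sum_mul_conj_le (u := p) (v := v - q) zero_le_two hε hp hvq
  have h3 := abs_le.1 ((Complex.abs_im_le_norm _).trans h1)
  have h4 := abs_le.1 ((Complex.abs_im_le_norm _).trans h2)
  rw [e, Complex.sub_im, Complex.sub_im, huv, abs_le]
  constructor <;> linarith

lemma sum_mul_le_of_sum_sq_le {ι : Type*} [Fintype ι] {f h : ι → ℝ} {a b : ℝ} (ha : 0 ≤ a)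
    (hb : 0 ≤ b) (hf : ∑ i, f i ^ 2 ≤ a ^ 2) (hh : ∑ i, h i ^ 2 ≤ b ^ 2) :
    ∑ i, f i * h i ≤ a * b := by
  refine abs_le_of_sq_le_sq' ?_ (by positivity) |>.2
  rw [mul_pow]
  exact (Finset.sum_mul_sq_le_sq_mul_sq _ _ _).trans
    (mul_le_mul hf hh (Finset.sum_nonneg fun _ _ => sq_nonneg _) (by positivity))

lemma abs_rowProd_le {n : ℕ} {u v p q : Fin n → ℂ} {g : Fin n → ℝ × ℝ}
    (h : rowProd u v g = 0) :
    |rowProd p q g| ≤ ‖rowLin g (u - p)‖ * ‖rowLin g v‖ + ‖rowLin g p‖ * ‖rowLin g (v - q)‖ := by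
  have e : rowProd p q g = rowProd u v g -
      (rowLin g (u - p) * starRingEnd ℂ (rowLin g v)).re -
      (rowLin g p * starRingEnd ℂ (rowLin g (v - q))).re := by
    simp only [rowProd, map_sub, rowLin_apply, ← Complex.sub_re]
    congr 1
    ring
  have h1 := abs_le.1 (Complex.abs_re_le_norm (rowLin g (u - p) * starRingEnd ℂ (rowLin g v)))
  have h2 := abs_le.1 (Complex.abs_re_le_norm (rowLin g p * starRingEnd ℂ (rowLin g (v - q))))
  rw [norm_mul, RCLike.norm_conj] at h1 h2
  rw [e, h, abs_le]
  constructor <;> linarith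

lemma sum_abs_rowProd_le {n m : ℕ} {u v p q : Fin n → ℂ} {g : Fin m → Fin n → ℝ × ℝ} {ε : ℝ}
    (hε : 0 ≤ ε) (hε1 : ε ≤ 1)
    (h : ∀ i, rowProd u v (g i) = 0)
    (hp : ∑ i, ‖rowForm p (g i)‖ ^ 2 ≤ 9 * m) (hq : ∑ i, ‖rowForm q (g i)‖ ^ 2 ≤ 9 * m)
    (hup : ∑ i, ‖rowLin (g i) (u - p)‖ ^ 2 ≤ m * ε ^ 2)
    (hvq : ∑ i, ‖rowLin (g i) (v - q)‖ ^ 2 ≤ m * ε ^ 2) :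
    ∑ i, |rowProd p q (g i)| ≤ 8 * ε * m := by
  have hm : (0:ℝ) ≤ m := m.cast_nonneg
  have hs : √(m:ℝ) ^ 2 = m := Real.sq_sqrt hm
  have hv : ∑ i, ‖rowLin (g i) v‖ ^ 2 ≤ 20 * m := by
    have : ∀ i, ‖rowLin (g i) v‖ ^ 2 ≤
        2 * ‖rowForm q (g i)‖ ^ 2 + 2 * ‖rowLin (g i) (v - q)‖ ^ 2 := fun i => by
      have h1 : ‖rowLin (g i) v‖ ≤ ‖rowForm q (g i)‖ + ‖rowLin (g i) (v - q)‖ := by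
        rw [← rowLin_apply]
        refine le_trans (le_of_eq ?_) (norm_add_le _ _)
        rw [map_sub]; ring_nf
      nlinarith [norm_nonneg (rowLin (g i) v), sq_nonneg (‖rowForm q (g i)‖ -
        ‖rowLin (g i) (v - q)‖)]
    have h2 := Finset.sum_le_sum fun i (_ : i ∈ Finset.univ) => this i
    rw [Finset.sum_add_distrib, ← Finset.mul_sum, ← Finset.mul_sum] at h2
    have : m * ε ^ 2 ≤ m * 1 := mul_le_mul_of_nonneg_left (by nlinarith) hm
    linarith
  have h1 := sum_mul_le_of_sum_sq_le (f := fun i => ‖rowLin (g i) (u - p)‖)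
    (h := fun i => ‖rowLin (g i) v‖) (a := √m * ε) (b := 5 * √m) (by positivity) (by positivity)
    (by rw [mul_pow, hs]; exact hup) (by rw [mul_pow, hs]; linarith)
  have h2 := sum_mul_le_of_sum_sq_le (f := fun i => ‖rowLin (g i) p‖)
    (h := fun i => ‖rowLin (g i) (v - q)‖) (a := 3 * √m) (b := √m * ε) (by positivity)
    (by positivity) (by rw [mul_pow, hs]; norm_num; exact hp) (by rw [mul_pow, hs]; exact hvq)
  calc ∑ i, |rowProd p q (g i)| ≤ ∑ i, (‖rowLin (g i) (u - p)‖ * ‖rowLin (g i) v‖ +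
        ‖rowLin (g i) p‖ * ‖rowLin (g i) (v - q)‖) :=
        Finset.sum_le_sum fun i _ => abs_rowProd_le (h i)
    _ ≤ √m * ε * (5 * √m) + 3 * √m * (√m * ε) := by
        rw [Finset.sum_add_distrib]; exact add_le_add h1 h2
    _ = 8 * ε * √m ^ 2 := by ring
    _ = _ := by rw [hs]

/-- The pairs of vectors for which `rowProd` is controlled from below. -/
def IsSpreadPair {n : ℕ} (u v : Fin n → ℂ) : Prop :=
  1 / 2 ≤ normSqSum u * normSqSum v - (∑ j, u j * starRingEnd ℂ (v j)).im ^ 2 ∧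
    normSqSum u ^ 4 ≤ 2 ∧ normSqSum v ^ 4 ≤ 2

/-- The matrix with rows `g i` is bounded on the net points, and `rowProd` is large on average
over the rows for all pairs of net points that are spread. -/
def NetGood {m n : ℕ} (D : ℝ) (N : ℕ) (g : Fin m → Fin n → ℝ × ℝ) : Prop :=
  (∀ s : Sym (Fin n × Fin 4) N,
    ∑ i, ‖rowForm (netPoint D s) (g i)‖ ^ 2 ≤ 8 * m * normSqSum (netPoint D s)) ∧
  ∀ s t : Sym (Fin n × Fin 4) N, IsSpreadPair (netPoint D s) (netPoint D t) →
    m / 2 ^ 11 < ∑ i, |rowProd (netPoint D s) (netPoint D t) (g i)|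

lemma NetGood.exists_approx {m n N : ℕ} {D : ℝ} {g : Fin m → Fin n → ℝ × ℝ}
    (h : NetGood D N g) (hn : 0 < n) (hm : 0 < m) (hN : 0 < N) (hD : 0 < D)
    (hDN : 9 * D ^ 2 * 2 ^ 30 ≤ N) {w : Fin n → ℂ} (hw : 2 * ∑ j, ‖w j‖ ≤ D) :
    ∃ s : Sym (Fin n × Fin 4) N, normSqSum (w - netPoint D s) ≤ (1 / 2 ^ 15) ^ 2 ∧
      ∑ i, ‖rowLin (g i) (w - netPoint D s)‖ ^ 2 ≤ m * (1 / 2 ^ 15) ^ 2 := by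
  have hm' : (0:ℝ) < m := by exact_mod_cast hm
  have hN' : (0:ℝ) < N := by exact_mod_cast hN
  obtain ⟨s, h1, h2⟩ := exists_netPoint_approx hn hm hN hD (fun i => rowLin (g i))
    (B := 9 * D ^ 2) (fun i => by
      have := h.1 (Sym.replicate N i)
      rw [netPoint_replicate hN, normSqSum_cornerVec] at this
      have h3 : (∑ r, ‖rowLin (g r) (cornerVec D i)‖ ^ 2) / m ≤ 8 * D ^ 2 := by
        rw [div_le_iff₀ hm']
        simp only [rowLin_apply]
        linarith
      rw [normSqSum_cornerVec]
      linarith) hw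
  have h4 : 9 * D ^ 2 / N ≤ (1 / 2 ^ 15) ^ 2 := by
    rw [div_le_iff₀ hN']
    linarith
  exact ⟨s, h1.trans h4, h2.trans (mul_le_mul_of_nonneg_left h4 hm'.le)⟩

lemma NetGood.exists_rowProd_ne_zero {m n N : ℕ} {D : ℝ} {g : Fin m → Fin n → ℝ × ℝ}
    (h : NetGood D N g) (hn : 0 < n) (hm : 0 < m) (hN : 0 < N) (hD : 0 < D)
    (hDN : 9 * D ^ 2 * 2 ^ 30 ≤ N) {u v : Fin n → ℂ} (hu1 : normSqSum u = 1)
    (hv1 : normSqSum v = 1) (huv : (∑ j, u j * starRingEnd ℂ (v j)).im = 0)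
    (hu : 2 * ∑ j, ‖u j‖ ≤ D) (hv : 2 * ∑ j, ‖v j‖ ≤ D) :
    ∃ i, rowProd u v (g i) ≠ 0 := by
  by_contra! hcon
  have hm' : (0:ℝ) < m := by exact_mod_cast hm
  obtain ⟨s, hs1, hs2⟩ := h.exists_approx hn hm hN hD hDN hu
  obtain ⟨t, ht1, ht2⟩ := h.exists_approx hn hm hN hD hDN hv
  have ps := abs_le.1 (abs_normSqSum_sub_sub_one_le (by positivity) (by norm_num) hu1 hs1)
  have pt := abs_le.1 (abs_normSqSum_sub_sub_one_le (by positivity) (by norm_num) hv1 ht1)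
  have him := abs_im_sum_mul_conj_le (by positivity) hv1 huv (by norm_num at *; linarith) hs1 ht1
  have h1 := h.1 s
  have h2 := h.1 t
  have hpair : IsSpreadPair (netPoint D s) (netPoint D t) := by
    have key : ∀ c : ℝ, -(3 * (1 / 2 ^ 15)) ≤ c - 1 ∧ c - 1 ≤ 3 * (1 / 2 ^ 15) →
        7 / 8 ≤ c ∧ c ≤ 9 / 8 := fun c hc => by
      norm_num at hc
      constructor <;> linarith
    have ka := key _ ps
    have kb := key _ pt
    have pow4 : ∀ c : ℝ, 7 / 8 ≤ c ∧ c ≤ 9 / 8 → c ^ 4 ≤ 2 := fun c hc =>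
      (pow_le_pow_left₀ (by linarith) hc.2 4).trans (by norm_num)
    refine ⟨?_, ?_, ?_⟩
    · have h3 : (∑ j, netPoint D s j * starRingEnd ℂ (netPoint D t j)).im ^ 2 ≤ (1 / 8) ^ 2 := by
        rw [← sq_abs]
        refine pow_le_pow_left₀ (abs_nonneg _) (him.trans (by norm_num)) 2
      nlinarith [mul_nonneg (sub_nonneg.2 ka.1) (sub_nonneg.2 kb.1)]
    · exact pow4 _ ka
    · exact pow4 _ kb
  have h3 := h.2 s t hpair
  have h4 := sum_abs_rowProd_le (by positivity) (by norm_num) hcon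
    (h1.trans (by norm_num at *; nlinarith)) (h2.trans (by norm_num at *; nlinarith)) hs2 ht2
  norm_num at h3 h4
  linarith

lemma rowProd_const_mul {n : ℕ} (a b : ℝ) (u v : Fin n → ℂ) (g : Fin n → ℝ × ℝ) :
    rowProd (fun j => (a : ℂ) * u j) (fun j => (b : ℂ) * v j) g = a * b * rowProd u v g := by
  simp only [rowProd, rowForm_const_mul, map_mul, Complex.conj_ofReal]
  rw [← Complex.re_ofReal_mul]
  congr 1
  push_cast
  ring

lemma NetGood.exists_rowProd_ne_zero_of_pos {m n k N : ℕ} {g : Fin m → Fin n → ℝ × ℝ}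
    (h : NetGood (12 * √k) N g) (hn : 0 < n) (hm : 0 < m) (hk : 0 < k)
    (hkN : 1296 * 2 ^ 30 * k ≤ N) {u v : Fin n → ℂ} (hu0 : 0 < normSqSum u)
    (hv0 : 0 < normSqSum v) (huv : (∑ j, u j * starRingEnd ℂ (v j)).im = 0)
    (hu : ∑ j, ‖u j‖ ≤ 6 * √k * √(normSqSum u)) (hv : ∑ j, ‖v j‖ ≤ 6 * √k * √(normSqSum v)) :
    ∃ i, rowProd u v (g i) ≠ 0 := by
  have hk' : (0:ℝ) < k := by exact_mod_cast hk
  have hN : 0 < N := lt_of_lt_of_le (by positivity) hkN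
  have hunit : ∀ w : Fin n → ℂ, 0 < normSqSum w →
      normSqSum (fun j => ((√(normSqSum w))⁻¹ : ℝ) * w j) = 1 := fun w hw => by
    rw [normSqSum_const_mul, Complex.norm_real, Real.norm_of_nonneg (by positivity), inv_pow,
      Real.sq_sqrt hw.le, inv_mul_cancel₀ hw.ne']
  have hl1 : ∀ w : Fin n → ℂ, 0 < normSqSum w → ∑ j, ‖w j‖ ≤ 6 * √k * √(normSqSum w) →
      2 * ∑ j, ‖((√(normSqSum w))⁻¹ : ℝ) * w j‖ ≤ 12 * √k := fun w hw hw1 => by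
    have : 0 < √(normSqSum w) := Real.sqrt_pos.2 hw
    simp only [norm_mul, Complex.norm_real, ← Finset.mul_sum,
      Real.norm_of_nonneg (inv_nonneg.2 this.le)]
    rw [inv_mul_eq_div, ← mul_div_assoc, div_le_iff₀ this]
    linarith
  obtain ⟨i, hi⟩ := h.exists_rowProd_ne_zero hn hm hN (by positivity) (by
      rw [mul_pow, Real.sq_sqrt hk'.le]
      have : ((1296 * 2 ^ 30 * k : ℕ) : ℝ) ≤ N := by exact_mod_cast hkN
      push_cast at this
      linarith) (hunit u hu0) (hunit v hv0) (by
      have : ∑ j, ((√(normSqSum u))⁻¹ : ℝ) * u j *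
          starRingEnd ℂ (((√(normSqSum v))⁻¹ : ℝ) * v j) =
          (((√(normSqSum u))⁻¹ * (√(normSqSum v))⁻¹ : ℝ) : ℂ) *
            ∑ j, u j * starRingEnd ℂ (v j) := by
        rw [Finset.mul_sum]
        refine Finset.sum_congr rfl fun j _ => ?_
        rw [map_mul, Complex.conj_ofReal]
        push_cast
        ring
      rw [this, Complex.im_ofReal_mul, huv, mul_zero]) (hl1 u hu0 hu) (hl1 v hv0 hv)
  refine ⟨i, fun h0 => hi ?_⟩
  rw [rowProd_const_mul, h0, mul_zero]

lemma sum_norm_le_sqrt_mul {ι : Type*} [Fintype ι] {k : ℕ} {T : Finset ι} (hT : T.card ≤ k)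
    (w : ι → ℂ) : ∑ j ∈ T, ‖w j‖ ≤ √k * √(normSqSum w) := by
  rw [← Real.sqrt_mul k.cast_nonneg]
  refine Real.le_sqrt_of_sq_le ?_
  refine sq_sum_le_card_mul_sum_sq.trans ?_
  have hT' : (T.card : ℝ) ≤ k := by exact_mod_cast hT
  have h1 : ∑ j ∈ T, ‖w j‖ ^ 2 ≤ normSqSum w :=
    Finset.sum_le_sum_of_subset_of_nonneg (Finset.subset_univ T) fun _ _ _ => by positivity
  exact mul_le_mul hT' h1 (Finset.sum_nonneg fun _ _ => by positivity) k.cast_nonneg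

/-- The cone condition for the error vector of an `ℓ₁` minimizer. -/
lemma sum_compl_norm_sub_le {ι : Type*} [Fintype ι] [DecidableEq ι] {a y : ι → ℂ}
    (h : ∑ j, ‖a j‖ ≤ ∑ j, ‖y j‖) (T : Finset ι) :
    ∑ j ∈ Tᶜ, ‖a j - y j‖ ≤ ∑ j ∈ T, ‖a j - y j‖ + 2 * ∑ j ∈ Tᶜ, ‖y j‖ := by
  rw [← Finset.sum_add_sum_compl T, ← Finset.sum_add_sum_compl T (fun j => ‖y j‖)] at h
  have h1 : ∑ j ∈ T, ‖y j‖ ≤ ∑ j ∈ T, ‖a j‖ + ∑ j ∈ T, ‖a j - y j‖ := by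
    rw [← Finset.sum_add_distrib]
    refine Finset.sum_le_sum fun j _ => ?_
    have := norm_sub_le (a j) (a j - y j)
    rwa [sub_sub_cancel] at this
  have h2 : ∑ j ∈ Tᶜ, ‖a j - y j‖ ≤ ∑ j ∈ Tᶜ, ‖a j‖ + ∑ j ∈ Tᶜ, ‖y j‖ := by
    rw [← Finset.sum_add_distrib]
    exact Finset.sum_le_sum fun j _ => norm_sub_le _ _
  linarith

lemma NetGood.error_le {m n k N : ℕ} {g : Fin m → Fin n → ℝ × ℝ}
    (h : NetGood (12 * √k) N g) (hn : 0 < n) (hm : 0 < m) (hk : 0 < k)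
    (hkN : 1296 * 2 ^ 30 * k ≤ N) {a y : Fin n → ℂ}
    (hrow : ∀ i, ‖rowForm a (g i)‖ = ‖rowForm y (g i)‖) (hay : ∑ j, ‖a j‖ ≤ ∑ j, ‖y j‖)
    (hre : 0 ≤ (∑ j, a j * starRingEnd ℂ (y j)).re)
    (him : (∑ j, a j * starRingEnd ℂ (y j)).im = 0) {T : Finset (Fin n)} (hT : T.card ≤ k) :
    √k * √(normSqSum fun j => a j - y j) ≤ ∑ j ∈ Tᶜ, ‖y j‖ ∧
      ∑ j, ‖a j - y j‖ ≤ 4 * ∑ j ∈ Tᶜ, ‖y j‖ := by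
  have hk' : (0:ℝ) < √k := Real.sqrt_pos.2 (by exact_mod_cast hk)
  set u : Fin n → ℂ := fun j => a j - y j with hu
  set v : Fin n → ℂ := fun j => a j + y j with hv
  set σ := ∑ j ∈ Tᶜ, ‖y j‖ with hσ
  have hσ0 : 0 ≤ σ := Finset.sum_nonneg fun _ _ => norm_nonneg _
  have hcone := sum_compl_norm_sub_le hay T
  have huT : ∑ j ∈ T, ‖a j - y j‖ ≤ √k * √(normSqSum u) := sum_norm_le_sqrt_mul hT u
  have hvT : ∑ j ∈ T, ‖v j‖ ≤ √k * √(normSqSum v) := sum_norm_le_sqrt_mul hT v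
  have hu1 : ∑ j, ‖a j - y j‖ ≤ 2 * (√k * √(normSqSum u)) + 2 * σ := by
    rw [← Finset.sum_add_sum_compl T]
    linarith
  suffices hmain : √k * √(normSqSum u) ≤ σ from ⟨hmain, by linarith⟩
  by_contra! hlt
  have hupos : 0 < √(normSqSum u) := by
    by_contra! h0
    nlinarith [mul_nonpos_of_nonneg_of_nonpos hk'.le h0]
  have hu0 : 0 < normSqSum u := Real.sqrt_pos.1 hupos
  have huv : normSqSum u ≤ normSqSum v := by
    have e : u = fun j => a j + -1 * y j := by ext j; simp [hu, sub_eq_add_neg]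
    have h1 := normSqSum_add a y
    have h2 := normSqSum_add a (fun j => -1 * y j)
    rw [← e, normSqSum_const_mul] at h2
    have h3 : (∑ j, a j * starRingEnd ℂ (-1 * y j)).re =
        -(∑ j, a j * starRingEnd ℂ (y j)).re := by
      simp only [neg_one_mul, map_neg, mul_neg, Finset.sum_neg_distrib, Complex.neg_re]
    rw [h3] at h2
    simp only [norm_neg, norm_one] at h2
    rw [hv]
    linarith
  have hsq : √(normSqSum u) ≤ √(normSqSum v) := Real.sqrt_le_sqrt huv
  have hksq := mul_le_mul_of_nonneg_left hsq hk'.le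
  have hv1 : ∑ j, ‖v j‖ ≤ 6 * √k * √(normSqSum v) := by
    have h1 : ∑ j ∈ Tᶜ, ‖v j‖ ≤ ∑ j ∈ Tᶜ, ‖a j - y j‖ + 2 * σ := by
      rw [hσ, Finset.mul_sum, ← Finset.sum_add_distrib]
      refine Finset.sum_le_sum fun j _ => ?_
      have h2 := norm_add_le (a j - y j) (2 * y j)
      rw [norm_mul, Complex.norm_ofNat] at h2
      have : v j = a j - y j + 2 * y j := by simp only [hv]; ring
      rwa [this]
    rw [← Finset.sum_add_sum_compl T]
    linarith
  obtain ⟨i, hi⟩ := h.exists_rowProd_ne_zero_of_pos hn hm hk hkN hu0 (hu0.trans_le huv) (by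
    have : ∑ j, u j * starRingEnd ℂ (v j) = ((normSqSum a - normSqSum y : ℝ) : ℂ) +
        (∑ j, a j * starRingEnd ℂ (y j) - starRingEnd ℂ (∑ j, a j * starRingEnd ℂ (y j))) := by
      simp only [normSqSum, map_sum, map_mul, Complex.conj_conj, Complex.ofReal_sub,
        Complex.ofReal_sum, ← Finset.sum_sub_distrib, ← Finset.sum_add_distrib]
      refine Finset.sum_congr rfl fun j _ => ?_
      simp only [hu, hv, map_add, Complex.ofReal_pow, ← Complex.mul_conj']
      ring
    rw [this, Complex.add_im, Complex.ofReal_im, Complex.sub_im, Complex.conj_im, him]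
    simp) (by linarith) hv1
  apply hi
  have h1 : rowForm u (g i) = rowForm a (g i) - rowForm y (g i) :=
    map_sub (rowLin (g i)) a y
  have h2 : rowForm v (g i) = rowForm a (g i) + rowForm y (g i) := rowForm_add a y (g i)
  have h3 := congrArg (· ^ 2) (hrow i)
  simp only [Complex.sq_norm, Complex.normSq_apply] at h3
  rw [rowProd, h1, h2]
  simp
  linarith

lemma exists_phase_sum_mul_conj_nonneg {ι : Type*} [Fintype ι] (a x : ι → ℂ) :
    ∃ c : ℂ, ‖c‖ = 1 ∧ 0 ≤ (∑ j, a j * starRingEnd ℂ (c * x j)).re ∧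
      (∑ j, a j * starRingEnd ℂ (c * x j)).im = 0 := by
  have e : ∀ c : ℂ, ∑ j, a j * starRingEnd ℂ (c * x j) =
      starRingEnd ℂ c * ∑ j, a j * starRingEnd ℂ (x j) := fun c => by
    rw [Finset.mul_sum]
    refine Finset.sum_congr rfl fun j _ => ?_
    rw [map_mul]
    ring
  simp_rw [e]
  set S := ∑ j, a j * starRingEnd ℂ (x j)
  rcases eq_or_ne S 0 with h | h
  · exact ⟨1, by simp [h]⟩
  · have hS : (‖S‖ : ℂ) ≠ 0 := by simpa using h
    have : starRingEnd ℂ (S / ‖S‖) * S = (‖S‖ : ℝ) := by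
      rw [map_div₀, Complex.conj_ofReal, div_mul_eq_mul_div, Complex.conj_mul', sq,
        mul_div_assoc, div_self hS, mul_one]
    refine ⟨S / ‖S‖, ?_, ?_, ?_⟩
    · rw [norm_div, Complex.norm_real, norm_norm, div_self (norm_ne_zero_iff.2 h)]
    · rw [this, Complex.ofReal_re]; exact norm_nonneg S
    · rw [this, Complex.ofReal_im]

lemma lpNorm_one_eq {ι : Type*} [Fintype ι] (x : ι → ℂ) : lpNorm 1 x = ∑ i, ‖x i‖ := by
  simp [_root_.lpNorm]

lemma lpNorm_two_eq {ι : Type*} [Fintype ι] (x : ι → ℂ) : lpNorm 2 x = √(normSqSum x) := by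
  simp [_root_.lpNorm, normSqSum, Real.sqrt_eq_rpow]

lemma phaseDist_le {ι : Type*} [Fintype ι] (q : ℝ) (x y : ι → ℂ) {c : ℂ} (hc : ‖c‖ = 1) :
    phaseDist q x y ≤ lpNorm q (fun i => x i - c * y i) := by
  refine csInf_le ⟨0, ?_⟩ ⟨c, hc, rfl⟩
  rintro d ⟨c, -, rfl⟩
  unfold _root_.lpNorm
  positivity

lemma le_sigmaK {ι : Type*} [Fintype ι] {k : ℕ} {q b : ℝ} {x : ι → ℂ}
    (h : ∀ z : ι → ℂ, l0Norm z ≤ k → b ≤ lpNorm q (fun i => x i - z i)) : b ≤ sigmaK k q x := by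
  refine le_csInf ⟨_, 0, by simp [l0Norm], rfl⟩ ?_
  rintro d ⟨z, hz, rfl⟩
  exact h z hz

lemma NetGood.phaseDist_le {m n k N : ℕ} {g : Fin m → Fin n → ℝ × ℝ}
    (h : NetGood (12 * √k) N g) (hn : 0 < n) (hm : 0 < m) (hk : 0 < k)
    (hkN : 1296 * 2 ^ 30 * k ≤ N) {x a : Fin n → ℂ}
    (hrow : ∀ i, ‖rowForm a (g i)‖ = ‖rowForm x (g i)‖) (hax : lpNorm 1 a ≤ lpNorm 1 x) :
    phaseDist 1 a x ≤ 4 * sigmaK k 1 x ∧ phaseDist 2 a x ≤ 4 * sigmaK k 1 x / √k := by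
  classical
  have hk' : (0:ℝ) < √k := Real.sqrt_pos.2 (by exact_mod_cast hk)
  obtain ⟨c, hc, hre, him⟩ := exists_phase_sum_mul_conj_nonneg a x
  have key : ∀ z : Fin n → ℂ, l0Norm z ≤ k →
      √k * lpNorm 2 (fun i => a i - c * x i) ≤ lpNorm 1 (fun i => x i - z i) ∧
      lpNorm 1 (fun i => a i - c * x i) ≤ 4 * lpNorm 1 (fun i => x i - z i) := by
    intro z hz
    have h1 := h.error_le hn hm hk hkN (a := a) (y := fun j => c * x j)
      (fun i => by rw [rowForm_const_mul, norm_mul, hc, one_mul, hrow])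
      (by simpa [lpNorm_one_eq, hc] using hax) hre him
      (T := Finset.univ.filter fun i => z i ≠ 0) (by unfold l0Norm at hz; convert hz)
    have h2 : ∑ j ∈ (Finset.univ.filter fun i => z i ≠ 0)ᶜ, ‖c * x j‖ ≤
        lpNorm 1 (fun i => x i - z i) := by
      rw [lpNorm_one_eq]
      calc _ = ∑ j ∈ (Finset.univ.filter fun i => z i ≠ 0)ᶜ, ‖x j - z j‖ := by
            refine Finset.sum_congr rfl fun j hj => ?_
            have : z j = 0 := by simpa using hj
            rw [norm_mul, hc, one_mul, this, sub_zero]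
        _ ≤ _ := Finset.sum_le_sum_of_subset_of_nonneg (Finset.subset_univ _)
            fun _ _ _ => norm_nonneg _
    rw [lpNorm_two_eq, lpNorm_one_eq fun i => a i - c * x i]
    exact ⟨h1.1.trans h2, h1.2.trans (by linarith)⟩
  have hl2 : 0 ≤ lpNorm 2 (fun i => a i - c * x i) := by rw [lpNorm_two_eq]; positivity
  constructor
  · have := le_sigmaK (x := x) (q := 1) (b := lpNorm 1 (fun i => a i - c * x i) / 4) fun z hz => by
      linarith [(key z hz).2]
    linarith [_root_.phaseDist_le 1 a x hc]
  · have h1 := le_sigmaK fun z hz => (key z hz).1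
    rw [le_div_iff₀ hk']
    have h2 := mul_le_mul_of_nonneg_right (_root_.phaseDist_le 2 a x hc) hk'.le
    nlinarith [mul_nonneg hk'.le hl2]

lemma measure_not_netGood_le (m n N : ℕ) (D : ℝ) :
    (Measure.pi fun _ : Fin m => rowLaw n) {g | ¬ NetGood D N g} ≤
      ENNReal.ofReal (2 * (Fintype.card (Sym (Fin n × Fin 4) N) : ℝ) ^ 2 *
        rexp (-(m / 2 ^ 17))) := by
  set P := Measure.pi fun _ : Fin m => rowLaw n
  set δ := rexp (-(m / 2 ^ 17 : ℝ)) with hδ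
  set K := Fintype.card (Sym (Fin n × Fin 4) N) with hK
  have hm : (0:ℝ) ≤ m := m.cast_nonneg
  have h1 : ∀ s : Sym (Fin n × Fin 4) N,
      P {g | 8 * m * normSqSum (netPoint D s) < ∑ i, ‖rowForm (netPoint D s) (g i)‖ ^ 2} ≤
        ENNReal.ofReal δ := fun s =>
    (measure_sum_norm_rowForm_sq_gt_le _ m).trans <| ENNReal.ofReal_le_ofReal <|
      Real.exp_le_exp.2 <| neg_le_neg <| div_le_self hm (by norm_num)
  have h2 : ∀ p : Sym (Fin n × Fin 4) N × Sym (Fin n × Fin 4) N,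
      P {g | IsSpreadPair (netPoint D p.1) (netPoint D p.2) ∧
        ∑ i, |rowProd (netPoint D p.1) (netPoint D p.2) (g i)| ≤ m / 2 ^ 11} ≤
        ENNReal.ofReal δ := fun p => by
    by_cases hp : IsSpreadPair (netPoint D p.1) (netPoint D p.2)
    · simp only [hp, true_and]
      exact measure_sum_abs_rowProd_le hp.1 hp.2.1 hp.2.2 m
    · simp [hp]
  have hsub : {g : Fin m → Fin n → ℝ × ℝ | ¬ NetGood D N g} ⊆
      (⋃ s : Sym (Fin n × Fin 4) N, {g | 8 * m * normSqSum (netPoint D s) <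
        ∑ i, ‖rowForm (netPoint D s) (g i)‖ ^ 2}) ∪
      ⋃ p : Sym (Fin n × Fin 4) N × Sym (Fin n × Fin 4) N,
        {g | IsSpreadPair (netPoint D p.1) (netPoint D p.2) ∧
          ∑ i, |rowProd (netPoint D p.1) (netPoint D p.2) (g i)| ≤ m / 2 ^ 11} := by
    intro g hg
    by_contra hcon
    simp only [Set.mem_union, Set.mem_iUnion, Set.mem_ofPred_eq, not_or, not_exists, not_and,
      not_lt, not_le] at hcon
    exact hg ⟨hcon.1, fun s t hst => hcon.2 (s, t) hst⟩
  have hKsq : (K : ℝ) ≤ (K : ℝ) ^ 2 := by exact_mod_cast Nat.le_self_pow two_ne_zero K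
  calc P {g | ¬ NetGood D N g} ≤ _ := measure_mono hsub
    _ ≤ ∑ _s : Sym (Fin n × Fin 4) N, ENNReal.ofReal δ +
        ∑ _p : Sym (Fin n × Fin 4) N × Sym (Fin n × Fin 4) N, ENNReal.ofReal δ :=
      (measure_union_le _ _).trans <| add_le_add
        ((measure_iUnion_fintype_le _ _).trans (Finset.sum_le_sum fun s _ => h1 s))
        ((measure_iUnion_fintype_le _ _).trans (Finset.sum_le_sum fun p _ => h2 p))
    _ = ENNReal.ofReal ((K + (K : ℝ) ^ 2) * δ) := by
      rw [Finset.sum_const, Finset.sum_const, Finset.card_univ, Finset.card_univ,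
        Fintype.card_prod, ← hK, ← ENNReal.ofReal_nsmul, ← ENNReal.ofReal_nsmul,
        ← ENNReal.ofReal_add (by positivity) (by positivity)]
      simp only [nsmul_eq_mul]
      push_cast
      ring_nf
    _ ≤ _ := by
      refine ENNReal.ofReal_le_ofReal (mul_le_mul_of_nonneg_right ?_ (Real.exp_nonneg _))
      linarith

lemma one_le_mul_log {k n : ℕ} (hk : 0 < k) (hkn : k ≤ n) :
    1 ≤ k * Real.log (rexp 1 * n / k) := by
  have hk' : (1:ℝ) ≤ k := by exact_mod_cast hk
  have hkn' : (k:ℝ) ≤ n := by exact_mod_cast hkn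
  have hn' : (0:ℝ) < n := by linarith
  have h : 1 ≤ Real.log (rexp 1 * n / k) := by
    rw [Real.le_log_iff_exp_le (by positivity), mul_div_assoc]
    exact le_mul_of_one_le_right (Real.exp_nonneg 1) ((one_le_div (by positivity)).2 hkn')
  nlinarith

lemma measure_not_netGood_le_exp {m n k : ℕ} (hk : 0 < k) (hkn : k ≤ n)
    (hm : 2 ^ 18 * (4 * (1296 * 2 ^ 30) + 1) * k * Real.log (rexp 1 * n / k) ≤ m) (D : ℝ) :
    (Measure.pi fun _ : Fin m => rowLaw n) {g | ¬ NetGood D (1296 * 2 ^ 30 * k) g} ≤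
      ENNReal.ofReal (rexp (-(1 / 2 ^ 18) * m)) := by
  refine (measure_not_netGood_le m n _ D).trans (ENNReal.ofReal_le_ofReal ?_)
  have hL := one_le_mul_log hk hkn
  have hcard := card_sym_le_exp (M := 1296 * 2 ^ 30) hk hkn (by norm_num)
  set L := k * Real.log (rexp 1 * n / k) with hLdef
  have h2 : (2:ℝ) ≤ rexp 1 := by have := Real.add_one_le_exp 1; linarith
  calc 2 * (Fintype.card (Sym (Fin n × Fin 4) (1296 * 2 ^ 30 * k)) : ℝ) ^ 2 *
        rexp (-(m / 2 ^ 17))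
      ≤ rexp 1 * rexp (2 * ((1296 * 2 ^ 30 : ℕ) : ℝ) * L) ^ 2 * rexp (-(m / 2 ^ 17)) := by
        gcongr
    _ = rexp (1 + 2 * (2 * ((1296 * 2 ^ 30 : ℕ) : ℝ) * L) + -(m / 2 ^ 17)) := by
        rw [Real.exp_add, Real.exp_add, ← Real.exp_nat_mul]
        push_cast
        ring_nf
    _ ≤ _ := by
        rw [Real.exp_le_exp]
        have hm' : 2 ^ 18 * (4 * (1296 * 2 ^ 30) + 1) * L ≤ m := by
          rw [hLdef, ← mul_assoc]; exact hm
        push_cast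
        linarith

/-- Corollary `(2,1) and (1,1)`, complex case: for a standard complex Gaussian
random matrix `A ∈ ℂ^{m×n}` with `m ≥ C₀·k·log(en/k)`, with probability at least
`1 - exp(-c₀ m)`, every `ℓ₁` minimizer `x♯` subject to `|Ax♯| = |Ax|` satisfies
`dist₁(x♯,x) ≤ C·σ_k(x)₁` and `dist(x♯,x) ≤ C·σ_k(x)₁/√k`. -/
theorem stmt10 :
    ∃ C₀ c₀ C : ℝ, 0 < C₀ ∧ 0 < c₀ ∧ 0 < C ∧
      ∀ k n m : ℕ, 0 < k → k ≤ n →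
        C₀ * k * Real.log (Real.exp 1 * n / k) ≤ m →
        ENNReal.ofReal (1 - Real.exp (-c₀ * m)) ≤
          gaussMatrixComplex m n
            {A : Fin m → Fin n → ℂ | ∀ x xs : Fin n → ℂ,
              (∀ i, absMv A xs i = absMv A x i) →
              (∀ z : Fin n → ℂ, (∀ i, absMv A z i = absMv A x i) → lpNorm 1 xs ≤ lpNorm 1 z) →
              phaseDist 1 xs x ≤ C * sigmaK k 1 x ∧
              phaseDist 2 xs x ≤ C * sigmaK k 1 x / Real.sqrt k} := by
  refine ⟨2 ^ 18 * (4 * (1296 * 2 ^ 30) + 1), 1 / 2 ^ 18, 4, by norm_num, by norm_num,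
    by norm_num, fun k n m hk hkn hm => ?_⟩
  have hm0 : 0 < m := by
    have h1 := one_le_mul_log hk hkn
    rw [mul_assoc] at hm
    have : (0:ℝ) < m := by linarith
    exact_mod_cast this
  set P := Measure.pi fun _ : Fin m => rowLaw n
  set G : Set (Fin m → Fin n → ℝ × ℝ) := {g | NetGood (12 * √k) (1296 * 2 ^ 30 * k) g}
  have hG : ENNReal.ofReal (1 - rexp (-(1 / 2 ^ 18) * m)) ≤ P G := by
    rw [ENNReal.ofReal_sub _ (Real.exp_nonneg _), ENNReal.ofReal_one, tsub_le_iff_right]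
    calc (1 : ENNReal) = P Set.univ := measure_univ.symm
      _ ≤ P G + P Gᶜ := by rw [← Set.union_compl_self G]; exact measure_union_le _ _
      _ ≤ _ := by gcongr; exact measure_not_netGood_le_exp hk hkn hm _
  have hmeas : Measurable fun g : Fin m → Fin n → ℝ × ℝ =>
      fun i j => ((g i j).1 : ℂ) + (g i j).2 * Complex.I := by fun_prop
  refine hG.trans ((measure_mono ?_).trans (Measure.le_map_apply hmeas.aemeasurable _))
  intro g hg x xs hrow hmin
  exact NetGood.phaseDist_le hg (hk.trans_le hkn) hm0 hk le_rfl hrow (hmin x fun _ => rfl)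
end

section
/- There exist universal constants C, C', c̃₁, c̃₂, c̃₃ > 0 such that the following holds for all positive integers k ≤ n and m with C·k·log(en/k) ≤ m, and every fixed x₀ ∈ ℝ^n. If A ∈ ℝ^{m×n} is a standard Gaussian random matrix, then with probability at least 1 − c̃₃·exp(−c̃₂·m) − exp(−√(m·n)) − 2m·exp(−c̃₁·m/log(en/m)): every x♯ ∈ ℝ^n satisfying |A x♯| = |A x₀| entrywise and ‖x♯‖₁ ≤ ‖z‖₁ for all z ∈ ℝ^n with |A z| = |A x₀| (that is, x♯ is a minimizer of the ℓ₁ norm subject to the phaseless constraint) satisfies dist(x♯, x₀) ≤ C'·σ_k(x₀)₂. -/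
open MeasureTheory ProbabilityTheory Real Finset

/-- The law of a standard Gaussian random matrix `A ∈ ℝ^{m×n}`: the product over the `m·n`
entries of the real Gaussian measure with mean `0` and variance `1`. -/
noncomputable def gaussMatrixReal (m n : ℕ) : Measure (Fin m → Fin n → ℝ) :=
  Measure.pi fun _ : Fin m => Measure.pi fun _ : Fin n => gaussianReal 0 1

/-- Transposing a standard Gaussian matrix gives a standard Gaussian matrix. -/
theorem gaussMatrixReal_map_swap (m n : ℕ) :
    (gaussMatrixReal m n).map (fun A j i => A i j) = gaussMatrixReal n m := by
  have key (m n : ℕ) : (Measure.pi fun _ : Fin m × Fin n => gaussianReal 0 1).map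
      (fun x i j => x (i, j)) = gaussMatrixReal m n := by
    have h := Measure.infinitePi_map_curry (ι := Fin m) (κ := Fin n)
      (fun _ _ => gaussianReal 0 1)
    simp only [Measure.infinitePi_eq_pi] at h
    exact h
  rw [← key m n, Measure.map_map (by fun_prop) (by fun_prop), ← key n m,
    ← Measure.pi_map_piCongrLeft (Equiv.prodComm (Fin m) (Fin n))
      (fun _ : Fin n × Fin m => gaussianReal 0 1), Measure.map_map (by fun_prop) (by fun_prop)]
  rfl

instance (m n : ℕ) : IsProbabilityMeasure (gaussMatrixReal m n) := by
  unfold gaussMatrixReal; infer_instance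

/-- A linear form of a standard Gaussian vector is a centred Gaussian variable. -/
theorem map_sum_mul_pi_gaussianReal {n : ℕ} (v : Fin n → ℝ) :
    (Measure.pi fun _ : Fin n => gaussianReal 0 1).map (fun a => ∑ j, a j * v j) =
      (gaussianReal 0 1).map (fun x => √(∑ j, v j ^ 2) * x) := by
  have : IsFiniteMeasure ((Measure.pi fun _ : Fin n => gaussianReal 0 1).map
    (fun a => ∑ j, a j * v j)) := Measure.isFiniteMeasure_map _ _
  apply Measure.ext_of_charFun
  ext t
  rw [gaussianReal_map_const_mul, charFun_gaussianReal, charFun_apply_real,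
    integral_map (Measurable.aemeasurable (by fun_prop)) (by fun_prop)]
  have h1 : ∀ a : Fin n → ℝ, Complex.exp (t * ((∑ j, a j * v j : ℝ) : ℂ) * Complex.I) =
      ∏ j, Complex.exp ((t * v j : ℝ) * (a j : ℂ) * Complex.I) := by
    intro a
    rw [← Complex.exp_sum]
    congr 1
    push_cast
    rw [Finset.mul_sum, Finset.sum_mul]
    exact Finset.sum_congr rfl fun j _ => by ring
  simp_rw [h1]
  rw [integral_fintype_prod_eq_prod (fun j (x : ℝ) => Complex.exp ((t * v j : ℝ) * (x : ℂ) * Complex.I))]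
  have h2 : ∀ j, ∫ x : ℝ, Complex.exp ((t * v j : ℝ) * (x : ℂ) * Complex.I) ∂gaussianReal 0 1 =
      Complex.exp (-((t * v j : ℝ) : ℂ) ^ 2 / 2) := by
    intro j
    rw [← charFun_apply_real, charFun_gaussianReal]
    simp [neg_div]
  simp_rw [h2]
  rw [← Complex.exp_sum]
  congr 1
  have h3 : (√(∑ j, v j ^ 2)) ^ 2 = ∑ j, v j ^ 2 :=
    Real.sq_sqrt (Finset.sum_nonneg fun _ _ => sq_nonneg _)
  have h4 : ∀ (q : NNReal), (q : ℝ) = (√(∑ j, v j ^ 2)) ^ 2 →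
     ∑ j, -((t * v j : ℝ) : ℂ) ^ 2 / 2 = t * ((0 : ℝ) : ℂ) * Complex.I - q * t ^ 2 / 2 := by
    intro q hq
    have : ((q : ℝ) : ℂ) = ((∑ j, v j ^ 2 : ℝ) : ℂ) := by rw [hq, h3]
    rw [show ((q : NNReal) : ℂ) = ((q : ℝ) : ℂ) from rfl, this]
    push_cast
    simp only [mul_zero, zero_mul, zero_sub]
    rw [Finset.sum_mul, Finset.sum_div, ← Finset.sum_neg_distrib]
    exact Finset.sum_congr rfl fun j _ => by ring
  rw [h4 (NNReal.mk (√(∑ j, v j ^ 2) ^ 2) (sq_nonneg _) * 1) (by simp)]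
  simp

theorem lintegral_prod_rows {m n : ℕ} (v : Fin n → ℝ) {f : ℝ → ENNReal} (hf : Measurable f) :
    ∫⁻ A, ∏ i, f (∑ j, A i j * v j) ∂gaussMatrixReal m n =
      (∫⁻ x, f (√(∑ j, v j ^ 2) * x) ∂gaussianReal 0 1) ^ m := by
  have hm : Measurable fun a : Fin n → ℝ => f (∑ j, a j * v j) := by fun_prop
  have hI := iIndepFun_pi (ι := Fin m) (μ := fun _ => Measure.pi fun _ : Fin n => gaussianReal 0 1)
    (X := fun _ a => f (∑ j, a j * v j)) (fun _ => hm.aemeasurable)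
  rw [gaussMatrixReal, lintegral_prod_eq_prod_lintegral_of_indepFun Finset.univ _ hI
    (fun i => hm.comp (measurable_pi_apply i))]
  have h1 (i : Fin m) : ∫⁻ A, f (∑ j, A i j * v j)
      ∂(Measure.pi fun _ : Fin m => Measure.pi fun _ : Fin n => gaussianReal 0 1) =
      ∫⁻ x, f (√(∑ j, v j ^ 2) * x) ∂gaussianReal 0 1 := by
    rw [← lintegral_map (μ := gaussianReal 0 1) hf (by fun_prop), ← map_sum_mul_pi_gaussianReal,
      lintegral_map hf (by fun_prop)]
    exact (measurePreserving_eval (fun _ : Fin m => Measure.pi fun _ : Fin n => gaussianReal 0 1)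
      i).lintegral_comp hm
  simp [h1]

theorem measure_rows_le {m n : ℕ} (v : Fin n → ℝ) {φ : ℝ → ℝ} (hφ : Measurable φ) (b r : ℝ)
    (hb : ∫⁻ x, ENNReal.ofReal (exp (φ (√(∑ j, v j ^ 2) * x))) ∂gaussianReal 0 1 ≤
      ENNReal.ofReal (exp b)) :
    gaussMatrixReal m n {A | r ≤ ∑ i, φ (∑ j, A i j * v j)} ≤ ENNReal.ofReal (exp (m * b - r)) := by
  have h1 := lintegral_prod_rows (m := m) v
    (f := fun y => ENNReal.ofReal (exp (φ y))) (by fun_prop)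
  have h2 := mul_meas_ge_le_lintegral₀ (μ := gaussMatrixReal m n)
    (f := fun A => ∏ i, ENNReal.ofReal (exp (φ (∑ j, A i j * v j))))
    (Measurable.aemeasurable (by fun_prop)) (ENNReal.ofReal (exp r))
  have h3 : {A : Fin m → Fin n → ℝ | ENNReal.ofReal (exp r) ≤
      ∏ i, ENNReal.ofReal (exp (φ (∑ j, A i j * v j)))} =
      {A | r ≤ ∑ i, φ (∑ j, A i j * v j)} := by
    ext A
    simp only [Set.mem_ofPred_eq]
    rw [← ENNReal.ofReal_prod_of_nonneg (fun _ _ => (exp_pos _).le), ← Real.exp_sum,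
      ENNReal.ofReal_le_ofReal_iff (exp_pos _).le, Real.exp_le_exp]
  rw [h3, h1] at h2
  have h4 : (∫⁻ x, ENNReal.ofReal (exp (φ (√(∑ j, v j ^ 2) * x))) ∂gaussianReal 0 1) ^ m ≤
      ENNReal.ofReal (exp (m * b)) := by
    refine (pow_le_pow_left' hb m).trans_eq ?_
    rw [← ENNReal.ofReal_pow (exp_pos _).le, ← Real.exp_nat_mul]
  rw [sub_eq_add_neg, Real.exp_add, ENNReal.ofReal_mul (exp_pos _).le, Real.exp_neg,
    ENNReal.ofReal_inv_of_pos (exp_pos _), ← div_eq_mul_inv, ENNReal.le_div_iff_mul_le, mul_comm]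
  · exact h2.trans h4
  · left; simpa using exp_pos r
  · left; simp

theorem measure_cols_le {m n : ℕ} (u : Fin m → ℝ) {φ : ℝ → ℝ} (hφ : Measurable φ) (b r : ℝ)
    (hb : ∫⁻ x, ENNReal.ofReal (exp (φ (√(∑ i, u i ^ 2) * x))) ∂gaussianReal 0 1 ≤
      ENNReal.ofReal (exp b)) :
    gaussMatrixReal m n {A | r ≤ ∑ j, φ (∑ i, A i j * u i)} ≤ ENNReal.ofReal (exp (n * b - r)) := by
  have h := measure_rows_le (m := n) u hφ b r hb
  rw [← gaussMatrixReal_map_swap m n, Measure.map_apply (by fun_prop)] at h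
  · exact h
  · exact measurableSet_le measurable_const (by fun_prop)

theorem lintegral_exp_sq_gaussianReal_le :
    ∫⁻ x, ENNReal.ofReal (exp (x ^ 2 / 4)) ∂gaussianReal 0 1 ≤ ENNReal.ofReal 2 := by
  have h2 : √(4 * π) ≤ 2 * √(2 * π) := by
    rw [show (4 : ℝ) * π = 2 * (2 * π) by ring, Real.sqrt_mul (by norm_num)]
    gcongr
    rw [Real.sqrt_le_left (by norm_num)]
    norm_num
  rw [gaussianReal_of_var_ne_zero _ one_ne_zero,
    lintegral_withDensity_eq_lintegral_mul _ (measurable_gaussianPDF _ _) (by fun_prop)]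
  have h1 : ∀ x : ℝ, (gaussianPDF 0 1 * fun x => ENNReal.ofReal (exp (x ^ 2 / 4))) x =
      ENNReal.ofReal ((√(2 * π))⁻¹ * exp (-(1 / 4) * x ^ 2)) := by
    intro x
    rw [Pi.mul_apply, gaussianPDF, ← ENNReal.ofReal_mul (gaussianPDFReal_nonneg _ _ _),
      gaussianPDFReal]
    simp only [NNReal.coe_one, mul_one, sub_zero]
    rw [mul_assoc, ← Real.exp_add]
    ring_nf
  simp_rw [h1]
  rw [← ofReal_integral_eq_lintegral_ofReal]
  · apply ENNReal.ofReal_le_ofReal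
    rw [integral_const_mul, integral_gaussian, inv_mul_le_iff₀ (by positivity)]
    rw [show π / (1 / 4) = 4 * π by ring]
    linarith
  · exact (integrable_exp_neg_mul_sq (by norm_num)).const_mul _
  · exact .of_forall fun x => by positivity

theorem gaussianReal_abs_lt_le (c : ℝ) :
    gaussianReal 0 1 {x | |x| < c} ≤ ENNReal.ofReal (2 * c) := by
  rw [gaussianReal_apply _ one_ne_zero]
  have hs : {x : ℝ | |x| < c} = Set.Ioo (-c) c := by ext; simp [abs_lt]
  calc ∫⁻ x in {x | |x| < c}, gaussianPDF 0 1 x ≤ ∫⁻ x in {x : ℝ | |x| < c}, 1 := by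
        refine lintegral_mono fun x => ?_
        rw [gaussianPDF, ENNReal.ofReal_le_one, gaussianPDFReal]
        have : (√(2 * π * (1 : NNReal)))⁻¹ ≤ 1 := by
          apply inv_le_one_of_one_le₀
          rw [Real.one_le_sqrt]
          have := Real.pi_gt_three
          simp only [NNReal.coe_one]
          linarith
        refine mul_le_one₀ this (exp_pos _).le ?_
        rw [Real.exp_le_one_iff]
        simp only [NNReal.coe_one]
        nlinarith [sq_nonneg x]
    _ = ENNReal.ofReal (2 * c) := by
        rw [setLIntegral_one, hs, Real.volume_Ioo]
        ring_nf

theorem le_gaussianReal_le_abs (t : ℝ) :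
    ENNReal.ofReal (exp (-t ^ 2 - 3)) ≤ gaussianReal 0 1 {x | t ≤ |x|} := by
  have hs : Set.Icc t (t + 1) ⊆ {x : ℝ | t ≤ |x|} := fun x hx => hx.1.trans (le_abs_self x)
  refine le_trans ?_ (measure_mono hs)
  rw [gaussianReal_apply _ one_ne_zero]
  calc ENNReal.ofReal (exp (-t ^ 2 - 3))
      = ∫⁻ x in Set.Icc t (t + 1), ENNReal.ofReal (exp (-t ^ 2 - 3)) := by
        simp [lintegral_const]
    _ ≤ _ := by
        refine setLIntegral_mono (measurable_gaussianPDF _ _) fun x hx => ?_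
        apply ENNReal.ofReal_le_ofReal
        rw [gaussianPDFReal]
        simp only [NNReal.coe_one, mul_one, sub_zero]
        have h1 : exp (-2) ≤ (√(2 * π))⁻¹ := by
          rw [Real.exp_neg]
          apply inv_anti₀ (by positivity)
          rw [Real.sqrt_le_left (exp_pos _).le, ← Real.exp_nat_mul]
          have := Real.pi_lt_four
          have h := Real.add_one_le_exp (((2 : ℕ) : ℝ) * 2)
          have h' : exp (((2 : ℕ) : ℝ) * 2) = exp 2 * exp 2 := by rw [← Real.exp_add]; norm_num
          have := Real.add_one_le_exp (2 : ℝ)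
          nlinarith
        have h2 : exp (-t ^ 2 - 1) ≤ exp (-x ^ 2 / 2) := by
          apply Real.exp_le_exp.2
          nlinarith [hx.1, hx.2, sq_nonneg (t - 1)]
        calc exp (-t ^ 2 - 3) = exp (-2) * exp (-t ^ 2 - 1) := by rw [← Real.exp_add]; ring_nf
          _ ≤ _ := by gcongr

theorem measure_cols_truncated_sq_le {m n : ℕ} (u : Fin m → ℝ) (hu : ∑ i, u i ^ 2 ≤ 1) {τ : ℝ}
    (hτ : 0 ≤ τ) (hn : 2 * n * exp (-τ ^ 2 / 4) ≤ m) :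
    gaussMatrixReal m n {A | 24 * (m : ℝ) ≤ ∑ j, max (|∑ i, A i j * u i| - τ) 0 ^ 2} ≤
      ENNReal.ofReal (exp (-5 * m)) := by
  have hs : √(∑ i, u i ^ 2) ≤ 1 := (Real.sqrt_le_sqrt hu).trans_eq Real.sqrt_one
  set s := √(∑ i, u i ^ 2)
  have hs0 : 0 ≤ s := Real.sqrt_nonneg _
  have hb : ∫⁻ x, ENNReal.ofReal (exp (max (|s * x| - τ) 0 ^ 2 / 4)) ∂gaussianReal 0 1 ≤
      ENNReal.ofReal (exp (2 * exp (-τ ^ 2 / 4))) := by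
    have hpt : ∀ x : ℝ, ENNReal.ofReal (exp (max (|s * x| - τ) 0 ^ 2 / 4)) ≤
        1 + ENNReal.ofReal (exp (-τ ^ 2 / 4)) * ENNReal.ofReal (exp (x ^ 2 / 4)) := by
      intro x
      rw [← ENNReal.ofReal_mul (exp_pos _).le, ← Real.exp_add, ← ENNReal.ofReal_one,
        ← ENNReal.ofReal_add zero_le_one (exp_pos _).le]
      apply ENNReal.ofReal_le_ofReal
      rcases le_total (|s * x|) τ with h | h
      · rw [max_eq_right (by linarith)]
        simpa using (exp_pos _).le
      · rw [max_eq_left (by linarith)]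
        have hx : |s * x| ≤ |x| := by
          rw [abs_mul, abs_of_nonneg hs0]
          exact mul_le_of_le_one_left (abs_nonneg _) hs
        have : exp ((|s * x| - τ) ^ 2 / 4) ≤ exp (-τ ^ 2 / 4 + x ^ 2 / 4) := by
          apply Real.exp_le_exp.2
          have h1 : |s * x| ^ 2 ≤ x ^ 2 := by
            rw [← sq_abs x]; exact pow_le_pow_left₀ (abs_nonneg _) hx 2
          nlinarith [mul_nonneg hτ (sub_nonneg.2 h)]
        linarith
    refine (lintegral_mono hpt).trans ?_
    rw [lintegral_add_left measurable_const, lintegral_const_mul _ (by fun_prop), lintegral_const,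
      measure_univ, mul_one]
    calc _ ≤ 1 + ENNReal.ofReal (exp (-τ ^ 2 / 4)) * ENNReal.ofReal 2 := by
          gcongr; exact lintegral_exp_sq_gaussianReal_le
      _ = ENNReal.ofReal (2 * exp (-τ ^ 2 / 4) + 1) := by
          rw [← ENNReal.ofReal_mul (exp_pos _).le, ← ENNReal.ofReal_one,
            ← ENNReal.ofReal_add zero_le_one (by positivity)]
          ring_nf
      _ ≤ _ := ENNReal.ofReal_le_ofReal (Real.add_one_le_exp _)
  have h := measure_cols_le (n := n) u (φ := fun y => max (|y| - τ) 0 ^ 2 / 4) (by fun_prop)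
    (2 * exp (-τ ^ 2 / 4)) (6 * m) hb
  refine (measure_mono ?_).trans (h.trans ?_)
  · intro A hA
    simp only [Set.mem_ofPred_eq] at hA ⊢
    rw [← Finset.sum_div]
    linarith
  · apply ENNReal.ofReal_le_ofReal
    apply Real.exp_le_exp.2
    linarith

theorem measure_rows_small_le {m n : ℕ} (v : Fin n → ℝ) (hv : 0 < √(∑ j, v j ^ 2)) :
    gaussMatrixReal m n {A | (m : ℝ) / 4 ≤
        #{i | |∑ j, A i j * v j| < exp (-13) * √(∑ j, v j ^ 2)}} ≤
      ENNReal.ofReal (exp (-2 * m)) := by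
  set s := √(∑ j, v j ^ 2)
  have hb : ∫⁻ x, ENNReal.ofReal (exp (if |s * x| < exp (-13) * s then 12 else 0))
      ∂gaussianReal 0 1 ≤ ENNReal.ofReal (exp 1) := by
    have hpt : ∀ x : ℝ, ENNReal.ofReal (exp (if |s * x| < exp (-13) * s then 12 else 0)) ≤
        1 + ENNReal.ofReal (exp 12) * Set.indicator {x : ℝ | |x| < exp (-13)} 1 x := by
      intro x
      have : |s * x| < exp (-13) * s ↔ |x| < exp (-13) := by
        rw [abs_mul, abs_of_pos hv, mul_comm, mul_lt_mul_iff_left₀ hv]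
      simp only [this]
      by_cases h : |x| < exp (-13) <;> simp [h]
    refine (lintegral_mono hpt).trans ?_
    have hms : MeasurableSet {x : ℝ | |x| < exp (-13)} :=
      measurableSet_lt (by fun_prop) measurable_const
    rw [lintegral_add_left measurable_const,
      lintegral_const_mul _ (measurable_one.indicator hms), lintegral_const, measure_univ, mul_one,
      lintegral_indicator_one hms]
    calc _ ≤ 1 + ENNReal.ofReal (exp 12) * ENNReal.ofReal (2 * exp (-13)) := by
          gcongr; exact gaussianReal_abs_lt_le _
      _ = ENNReal.ofReal (1 + 2 * exp (-1)) := by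
          rw [← ENNReal.ofReal_mul (exp_pos _).le, ← ENNReal.ofReal_one,
            ← ENNReal.ofReal_add zero_le_one (by positivity)]
          rw [mul_left_comm, ← Real.exp_add]
          norm_num
      _ ≤ _ := by
          apply ENNReal.ofReal_le_ofReal
          have h1 := Real.exp_one_gt_d9
          have h2 : exp (-1) * exp 1 = 1 := by rw [← Real.exp_add]; simp
          nlinarith [exp_pos (-1)]
  have h := measure_rows_le (m := m) v (φ := fun y => if |y| < exp (-13) * s then 12 else 0)
    (Measurable.ite (measurableSet_lt (by fun_prop) measurable_const) (by fun_prop) (by fun_prop))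
    1 (3 * m) hb
  refine (measure_mono ?_).trans (h.trans ?_)
  · intro A hA
    simp only [Set.mem_ofPred_eq] at hA ⊢
    rw [← Finset.sum_filter, Finset.sum_const, nsmul_eq_mul]
    linarith
  · apply ENNReal.ofReal_le_ofReal
    apply Real.exp_le_exp.2
    linarith

theorem measure_cols_large_le {m n : ℕ} (u : Fin m → ℝ) (hu : 0 < √(∑ i, u i ^ 2)) (t r : ℝ) :
    gaussMatrixReal m n {A | (#{j | t * √(∑ i, u i ^ 2) ≤ |∑ i, A i j * u i|} : ℝ) ≤ r} ≤
      ENNReal.ofReal (exp (r - n * exp (-t ^ 2 - 3) / 2)) := by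
  set s := √(∑ i, u i ^ 2)
  have hb : ∫⁻ x, ENNReal.ofReal (exp (if t * s ≤ |s * x| then -1 else 0))
      ∂gaussianReal 0 1 ≤ ENNReal.ofReal (exp (-(exp (-t ^ 2 - 3) / 2))) := by
    have hms : MeasurableSet {x : ℝ | t ≤ |x|} :=
      measurableSet_le measurable_const (by fun_prop)
    have hpt : ∀ x : ℝ, ENNReal.ofReal (exp (if t * s ≤ |s * x| then -1 else 0)) +
        ENNReal.ofReal (1 / 2) * Set.indicator {x : ℝ | t ≤ |x|} 1 x ≤ 1 := by
      intro x
      have : t * s ≤ |s * x| ↔ t ≤ |x| := by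
        rw [abs_mul, abs_of_pos hu, mul_comm s, mul_le_mul_iff_left₀ hu]
      by_cases h : t ≤ |x|
      · simp only [this, h, if_true, Set.indicator, Set.mem_ofPred_eq, Pi.one_apply, mul_one]
        rw [← ENNReal.ofReal_add (exp_pos _).le (by norm_num), ENNReal.ofReal_le_one]
        have h1 := Real.exp_one_gt_d9
        have h2 : exp (-1) * exp 1 = 1 := by rw [← Real.exp_add]; simp
        nlinarith [exp_pos (-1)]
      · simp only [this]
        simp [h]
    have hI := lintegral_mono (μ := gaussianReal 0 1) hpt
    rw [lintegral_add_right _ ((measurable_one.indicator hms).const_mul _),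
      lintegral_const_mul _ (measurable_one.indicator hms), lintegral_const, measure_univ, mul_one,
      lintegral_indicator_one hms] at hI
    have h1 : ENNReal.ofReal (exp (-t ^ 2 - 3) / 2) ≤
        ENNReal.ofReal (1 / 2) * gaussianReal 0 1 {x | t ≤ |x|} := by
      rw [show exp (-t ^ 2 - 3) / 2 = 1 / 2 * exp (-t ^ 2 - 3) by ring,
        ENNReal.ofReal_mul (by norm_num)]
      gcongr
      exact le_gaussianReal_le_abs t
    have h2 := (add_le_add_right h1 _).trans hI
    have h3 := ENNReal.le_sub_of_add_le_right ENNReal.ofReal_ne_top h2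
    refine h3.trans ?_
    rw [← ENNReal.ofReal_one, ← ENNReal.ofReal_sub _ (by positivity)]
    apply ENNReal.ofReal_le_ofReal
    have := Real.add_one_le_exp (-(exp (-t ^ 2 - 3) / 2))
    linarith
  have h := measure_cols_le (n := n) u (φ := fun y => if t * s ≤ |y| then -1 else 0)
    (Measurable.ite (measurableSet_le measurable_const (by fun_prop)) (by fun_prop) (by fun_prop))
    (-(exp (-t ^ 2 - 3) / 2)) (-r) hb
  refine (measure_mono ?_).trans (h.trans ?_)
  · intro A hA
    simp only [Set.mem_ofPred_eq] at hA ⊢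
    rw [← Finset.sum_filter, Finset.sum_const, nsmul_eq_mul]
    linarith
  · apply ENNReal.ofReal_le_ofReal
    apply Real.exp_le_exp.2
    linarith

theorem measure_rows_sq_le {m n : ℕ} (v : Fin n → ℝ) :
    gaussMatrixReal m n {A | 8 * (m : ℝ) * ∑ j, v j ^ 2 < ∑ i, (∑ j, A i j * v j) ^ 2} ≤
      ENNReal.ofReal (exp (-m)) := by
  have hs2 : √(∑ j, v j ^ 2) ^ 2 = ∑ j, v j ^ 2 :=
    Real.sq_sqrt (Finset.sum_nonneg fun _ _ => sq_nonneg _)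
  rcases (Real.sqrt_nonneg (∑ j, v j ^ 2)).eq_or_lt with hs | hs
  · have h0 : ∑ j, v j ^ 2 = 0 := by rw [← hs2, ← hs]; simp
    have hv : ∀ j, v j = 0 := fun j => by
      simpa using (Finset.sum_eq_zero_iff_of_nonneg fun _ _ => sq_nonneg _).1 h0 j
    simp [hv]
  set s := √(∑ j, v j ^ 2)
  have hb : ∫⁻ x, ENNReal.ofReal (exp ((s * x) ^ 2 / (4 * s ^ 2))) ∂gaussianReal 0 1 ≤
      ENNReal.ofReal (exp 1) := by
    have : ∀ x, (s * x) ^ 2 / (4 * s ^ 2) = x ^ 2 / 4 := fun x => by field_simp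
    simp_rw [this]
    refine lintegral_exp_sq_gaussianReal_le.trans (ENNReal.ofReal_le_ofReal ?_)
    have := Real.exp_one_gt_d9
    linarith
  have h := measure_rows_le (m := m) v (φ := fun y => y ^ 2 / (4 * s ^ 2)) (by fun_prop)
    1 (2 * m) hb
  refine (measure_mono ?_).trans (h.trans ?_)
  · intro A hA
    simp only [Set.mem_ofPred_eq] at hA ⊢
    rw [← hs2] at hA
    rw [← Finset.sum_div, le_div_iff₀ (by positivity)]
    linarith
  · apply ENNReal.ofReal_le_ofReal
    apply Real.exp_le_exp.2
    linarith

/-- The integer points of the `ℓ₁` ball of radius `R` in dimension `d`. -/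
noncomputable def intBall (d : ℕ) (R : ℝ) : Finset (Fin d → ℤ) :=
  (Fintype.piFinset fun _ : Fin d => Finset.Icc (-⌊R⌋) ⌊R⌋).filter
    fun z => ∑ i, |(z i : ℝ)| ≤ R

theorem mem_intBall {d : ℕ} {R : ℝ} {z : Fin d → ℤ} :
    z ∈ intBall d R ↔ ∑ i, |(z i : ℝ)| ≤ R := by
  simp only [intBall, Finset.mem_filter, Fintype.mem_piFinset, Finset.mem_Icc,
    and_iff_right_iff_imp]
  intro h i
  have h1 : |(z i : ℝ)| ≤ R :=
    (Finset.single_le_sum (f := fun i => |(z i : ℝ)|) (fun _ _ => abs_nonneg _)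
      (Finset.mem_univ i)).trans h
  have h2 : |z i| ≤ ⌊R⌋ := by
    rw [Int.le_floor]
    exact_mod_cast h1
  exact abs_le.1 h2

theorem sum_Icc_exp_neg_mul_abs_le {t : ℝ} (ht : 1 ≤ t) (N : ℕ) :
    ∑ z ∈ Finset.Icc (-(N : ℤ)) N, exp (-t * |(z : ℝ)|) ≤ 1 + 4 * exp (-t) := by
  have hq1 : exp (-t) * 2.7 ≤ 1 := by
    have h1 := Real.exp_one_gt_d9
    have h2 : exp (-1) * exp 1 = 1 := by rw [← Real.exp_add]; simp
    have h3 : exp (-t) ≤ exp (-1) := Real.exp_le_exp.2 (by linarith)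
    nlinarith [exp_pos (-t), exp_pos (-1)]
  set q := exp (-t) with hq
  have hq0 : 0 < q := exp_pos _
  have key : ∀ N : ℕ, ∑ z ∈ Finset.Icc (-(N : ℤ)) N, exp (-t * |(z : ℝ)|) ≤
      1 + 4 * q - 4 * q ^ (N + 1) := by
    intro N
    induction N with
    | zero => simp
    | succ N ih =>
      have hS : Finset.Icc (-((N + 1 : ℕ) : ℤ)) ((N + 1 : ℕ) : ℤ) =
          insert (-((N + 1 : ℕ) : ℤ)) (insert ((N + 1 : ℕ) : ℤ) (Finset.Icc (-(N : ℤ)) N)) := by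
        ext z
        simp only [Finset.mem_Icc, Finset.mem_insert]
        push_cast
        omega
      have he : exp (-t * (N + 1)) = q ^ (N + 1) := by
        rw [hq, ← Real.exp_nat_mul]
        push_cast
        ring_nf
      rw [hS, Finset.sum_insert, Finset.sum_insert]
      · have h1 : |((N : ℝ) + 1)| = N + 1 := abs_of_nonneg (by positivity)
        push_cast
        rw [abs_neg, h1, he]
        have h2 : 0 < q ^ (N + 1) := by positivity
        have h3 : q ^ (N + 1 + 1) * 2.7 ≤ q ^ (N + 1) := by
          rw [pow_succ, mul_assoc]
          exact mul_le_of_le_one_right h2.le hq1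
        linarith
      · simp
      · simp only [Finset.mem_insert, Finset.mem_Icc, not_or]
        push_cast
        omega
  have := key N
  have h2 : 0 < q ^ (N + 1) := by positivity
  linarith

theorem card_intBall_le {t : ℝ} (ht : 1 ≤ t) (d : ℕ) {R : ℝ} (hR : 0 ≤ R) :
    (#(intBall d R) : ℝ) ≤ exp (t * R + 4 * d * exp (-t)) := by
  obtain ⟨N, hN⟩ := Int.eq_ofNat_of_zero_le (Int.floor_nonneg.2 hR)
  have h1 : (#(intBall d R) : ℝ) * exp (-t * R) ≤
      ∑ z ∈ intBall d R, ∏ i, exp (-t * |(z i : ℝ)|) := by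
    rw [← nsmul_eq_mul, ← Finset.sum_const]
    refine Finset.sum_le_sum fun z hz => ?_
    rw [← Real.exp_sum, ← Finset.mul_sum]
    apply Real.exp_le_exp.2
    have := mem_intBall.1 hz
    nlinarith
  have h2 : ∑ z ∈ intBall d R, ∏ i, exp (-t * |(z i : ℝ)|) ≤
      ∑ z ∈ Fintype.piFinset fun _ : Fin d => Finset.Icc (-⌊R⌋) ⌊R⌋,
        ∏ i, exp (-t * |(z i : ℝ)|) :=
    Finset.sum_le_sum_of_subset_of_nonneg (Finset.filter_subset _ _)
      fun _ _ _ => Finset.prod_nonneg fun _ _ => (exp_pos _).le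
  rw [Finset.sum_prod_piFinset (Finset.Icc (-⌊R⌋) ⌊R⌋)
    (fun (_ : Fin d) (z : ℤ) => exp (-t * |(z : ℝ)|)), hN] at h2
  have h3 : ∏ _i : Fin d, ∑ z ∈ Finset.Icc (-(N : ℤ)) N, exp (-t * |(z : ℝ)|) ≤
      exp (4 * d * exp (-t)) := by
    calc _ ≤ ∏ _i : Fin d, exp (4 * exp (-t)) := by
          refine Finset.prod_le_prod
            (fun _ _ => Finset.sum_nonneg fun _ _ => (exp_pos _).le) fun _ _ => ?_
          have := Real.add_one_le_exp (4 * exp (-t))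
          have := sum_Icc_exp_neg_mul_abs_le ht N
          linarith
      _ = _ := by
          rw [Finset.prod_const, ← Real.exp_nat_mul, Finset.card_univ, Fintype.card_fin]
          ring_nf
  have h4 := (h1.trans h2).trans h3
  rw [Real.exp_add]
  calc (#(intBall d R) : ℝ) = exp (t * R) * (#(intBall d R) * exp (-t * R)) := by
        rw [mul_left_comm, ← Real.exp_add]; simp
    _ ≤ _ := by gcongr

/-- Rounding towards zero to a multiple of `η`. -/
theorem exists_int_rounding {η : ℝ} (hη : 0 < η) (x : ℝ) :
    ∃ z : ℤ, |η * z| ≤ |x| ∧ |x - η * z| ≤ η ∧ |x - η * z| ≤ |x| := by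
  have key : ∀ x : ℝ, 0 ≤ x → ∃ z : ℤ, |η * z| ≤ |x| ∧ |x - η * z| ≤ η ∧ |x - η * z| ≤ |x| := by
    intro x hx
    have h1 : η * ⌊x / η⌋ ≤ x := by
      have := Int.floor_le (x / η)
      rwa [le_div_iff₀ hη, mul_comm] at this
    have h2 : x ≤ η * ⌊x / η⌋ + η := by
      have := (Int.lt_floor_add_one (x / η)).le
      rw [div_le_iff₀ hη] at this
      linarith
    have h3 : (0 : ℝ) ≤ η * ⌊x / η⌋ :=
      mul_nonneg hη.le (by exact_mod_cast Int.floor_nonneg.2 (by positivity))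
    refine ⟨⌊x / η⌋, ?_⟩
    rw [abs_of_nonneg hx, abs_of_nonneg h3, abs_of_nonneg (sub_nonneg.2 h1)]
    exact ⟨h1, by linarith, by linarith⟩
  rcases le_total 0 x with hx | hx
  · exact key x hx
  · obtain ⟨z, h1, h2, h3⟩ := key (-x) (by linarith)
    refine ⟨-z, ?_⟩
    push_cast
    rw [mul_neg, abs_neg, ← abs_neg x, ← abs_neg (x - -(η * z)),
      show -(x - -(η * z)) = -x - η * z by ring]
    exact ⟨h1, h2, h3⟩

theorem exists_rounding {d : ℕ} {η : ℝ} (hη : 0 < η) (v : Fin d → ℝ) :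
    ∃ z : Fin d → ℤ, ∀ i, |η * z i| ≤ |v i| ∧ |v i - η * z i| ≤ η ∧
      |v i - η * z i| ≤ |v i| := by
  choose z hz using fun i => exists_int_rounding hη (v i)
  exact ⟨z, hz⟩

theorem rounding_mem_intBall {d : ℕ} {η R : ℝ} (hη : 0 < η) {v : Fin d → ℝ} {z : Fin d → ℤ}
    (hz : ∀ i, |η * z i| ≤ |v i|) (hv : ∑ i, |v i| ≤ η * R) : z ∈ intBall d R := by
  rw [mem_intBall]
  have h : ∑ i, |η * z i| ≤ η * R := (Finset.sum_le_sum fun i _ => hz i).trans hv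
  simp only [abs_mul, abs_of_pos hη, ← Finset.mul_sum] at h
  exact le_of_mul_le_mul_left h hη

/-- The Euclidean norm `√(∑ i, v i ^ 2)` of a vector given by its coordinates. -/
noncomputable def euclNorm {ι : Type*} [Fintype ι] (v : ι → ℝ) : ℝ := √(∑ i, v i ^ 2)

section euclNorm

variable {ι : Type*} [Fintype ι]

theorem euclNorm_eq_norm (v : ι → ℝ) : euclNorm v = ‖WithLp.toLp 2 v‖ := by
  simp [euclNorm, EuclideanSpace.norm_eq]

theorem euclNorm_nonneg (v : ι → ℝ) : 0 ≤ euclNorm v := Real.sqrt_nonneg _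

theorem euclNorm_sq (v : ι → ℝ) : euclNorm v ^ 2 = ∑ i, v i ^ 2 :=
  Real.sq_sqrt (Finset.sum_nonneg fun _ _ => sq_nonneg _)

theorem euclNorm_add_le (v w : ι → ℝ) : euclNorm (v + w) ≤ euclNorm v + euclNorm w := by
  simp only [euclNorm_eq_norm, WithLp.toLp_add]
  exact norm_add_le _ _

theorem euclNorm_smul (c : ℝ) (v : ι → ℝ) : euclNorm (c • v) = |c| * euclNorm v := by
  simp only [euclNorm_eq_norm, WithLp.toLp_smul, norm_smul, Real.norm_eq_abs]

theorem euclNorm_neg (v : ι → ℝ) : euclNorm (-v) = euclNorm v := by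
  simp [euclNorm]

theorem euclNorm_pos {v : ι → ℝ} (hv : v ≠ 0) : 0 < euclNorm v := by
  rw [euclNorm_eq_norm, norm_pos_iff]
  simpa using hv

theorem sum_mul_le_euclNorm (v w : ι → ℝ) : ∑ i, v i * w i ≤ euclNorm v * euclNorm w :=
  Real.sum_mul_le_sqrt_mul_sqrt _ _ _

theorem euclNorm_le_of_abs_le {v w : ι → ℝ} (h : ∀ i, |v i| ≤ |w i|) :
    euclNorm v ≤ euclNorm w :=
  Real.sqrt_le_sqrt (Finset.sum_le_sum fun i _ => sq_le_sq.2 (h i))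

theorem sum_abs_le_sqrt_card_mul (s : Finset ι) (v : ι → ℝ) :
    ∑ i ∈ s, |v i| ≤ √(#s) * euclNorm v := by
  have h := Real.sum_mul_le_sqrt_mul_sqrt s (fun _ => 1) (fun i => |v i|)
  simp only [one_mul, one_pow, Finset.sum_const, nsmul_eq_mul, mul_one, sq_abs] at h
  refine h.trans ?_
  gcongr
  exact Real.sqrt_le_sqrt (Finset.sum_le_sum_of_subset_of_nonneg (Finset.subset_univ s)
    fun _ _ _ => sq_nonneg _)

theorem euclNorm_le_sqrt_card_mul {v : ι → ℝ} {η : ℝ} (hη : 0 ≤ η) (h : ∀ i, |v i| ≤ η) :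
    euclNorm v ≤ √(Fintype.card ι) * η := by
  rw [← Real.sqrt_sq hη, ← Real.sqrt_mul (Nat.cast_nonneg _), euclNorm]
  apply Real.sqrt_le_sqrt
  calc ∑ i, v i ^ 2 ≤ ∑ _i : ι, η ^ 2 :=
        Finset.sum_le_sum fun i _ => by rw [← sq_abs]; exact pow_le_pow_left₀ (abs_nonneg _) (h i) 2
    _ = _ := by simp

end euclNorm

/-- The matrix-vector product. -/
def matVec {m n : ℕ} (A : Fin m → Fin n → ℝ) (d : Fin n → ℝ) : Fin m → ℝ :=
  fun i => ∑ j, A i j * d j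

theorem matVec_add {m n : ℕ} (A : Fin m → Fin n → ℝ) (d e : Fin n → ℝ) :
    matVec A (d + e) = matVec A d + matVec A e := by
  ext i; simp [matVec, mul_add, Finset.sum_add_distrib]

theorem matVec_smul {m n : ℕ} (A : Fin m → Fin n → ℝ) (c : ℝ) (d : Fin n → ℝ) :
    matVec A (c • d) = c • matVec A d := by
  ext i
  simp only [matVec, Pi.smul_apply, smul_eq_mul, Finset.mul_sum]
  exact Finset.sum_congr rfl fun j _ => by ring

theorem matVec_sub {m n : ℕ} (A : Fin m → Fin n → ℝ) (d e : Fin n → ℝ) :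
    matVec A (d - e) = matVec A d - matVec A e := by
  ext i; simp [matVec, mul_sub]

theorem matVec_neg {m n : ℕ} (A : Fin m → Fin n → ℝ) (d : Fin n → ℝ) :
    matVec A (-d) = -matVec A d := by
  ext i; simp [matVec]

theorem sum_mul_matVec {m n : ℕ} (A : Fin m → Fin n → ℝ) (u : Fin m → ℝ) (d : Fin n → ℝ) :
    ∑ i, u i * matVec A d i = ∑ j, (∑ i, A i j * u i) * d j := by
  simp only [matVec, Finset.mul_sum, Finset.sum_mul]
  rw [Finset.sum_comm]
  exact Finset.sum_congr rfl fun j _ => Finset.sum_congr rfl fun i _ => by ring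

theorem measure_exists_finset_le {α β : Type*} [MeasurableSpace α] (μ : Measure α) (S : Finset β)
    (P : β → α → Prop) {a b : ℝ} (hS : (#S : ℝ) ≤ exp a)
    (h : ∀ z ∈ S, μ {x | P z x} ≤ ENNReal.ofReal (exp b)) :
    μ {x | ∃ z ∈ S, P z x} ≤ ENNReal.ofReal (exp (a + b)) := by
  have h1 : {x | ∃ z ∈ S, P z x} = ⋃ z ∈ S, {x | P z x} := by ext; simp
  rw [h1]
  refine (measure_biUnion_finset_le _ _).trans ((Finset.sum_le_sum h).trans ?_)
  rw [Finset.sum_const, nsmul_eq_mul, Real.exp_add, ENNReal.ofReal_mul (exp_pos _).le]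
  gcongr
  rw [← ENNReal.ofReal_natCast]
  exact ENNReal.ofReal_le_ofReal hS

/-- The operator bound `‖A d‖₂ ≤ 10 √m ‖d‖₂ + 4 √L ‖d‖₁`. -/
def OpBound {m n : ℕ} (A : Fin m → Fin n → ℝ) (L : ℝ) : Prop :=
  ∀ d, euclNorm (matVec A d) ≤ 10 * √m * euclNorm d + 4 * √L * ∑ j, |d j|

theorem opBound_of_net {m n : ℕ} (hm : 0 < m) {A : Fin m → Fin n → ℝ} {L : ℝ}
    (hnet : ∀ z ∈ intBall m (2 * m), ∑ i, (1 / (2 * √m) * (z i : ℝ)) ^ 2 ≤ 1 →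
      ∑ j, max (|∑ i, A i j * (1 / (2 * √m) * (z i : ℝ))| - 2 * √L) 0 ^ 2 < 24 * m) :
    OpBound A L := by
  intro d
  have hm' : 0 < √(m : ℝ) := Real.sqrt_pos.2 (by exact_mod_cast hm)
  have hmm : √(m : ℝ) * √m = m := Real.mul_self_sqrt (by positivity)
  by_cases hx : matVec A d = 0
  · rw [hx]
    have h0 : euclNorm (0 : Fin m → ℝ) = 0 := by simp [euclNorm]
    rw [h0]
    have := euclNorm_nonneg d
    positivity
  set x := matVec A d with hxd
  have hN := euclNorm_pos hx
  set N := euclNorm x with hNd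
  set η : ℝ := 1 / (2 * √m) with hη
  have hη0 : 0 < η := by positivity
  set u₀ : Fin m → ℝ := N⁻¹ • x with hu₀
  have hu₀n : euclNorm u₀ = 1 := by
    rw [hu₀, euclNorm_smul, abs_of_pos (by positivity), inv_mul_cancel₀ hN.ne']
  obtain ⟨z, hz⟩ := exists_rounding hη0 u₀
  have h1 : ∑ i, |u₀ i| ≤ √m := by
    have := sum_abs_le_sqrt_card_mul Finset.univ u₀
    simpa [hu₀n] using this
  have hzm : z ∈ intBall m (2 * m) := by
    refine rounding_mem_intBall hη0 (fun i => (hz i).1) (h1.trans_eq ?_)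
    rw [hη]
    field_simp
    linarith [hmm]
  have hu1 : euclNorm (fun i => η * (z i : ℝ)) ≤ 1 :=
    (euclNorm_le_of_abs_le fun i => (hz i).1).trans_eq hu₀n
  have hu2 : ∑ i, (η * (z i : ℝ)) ^ 2 ≤ 1 := by
    rw [← euclNorm_sq]
    exact pow_le_one₀ (euclNorm_nonneg _) hu1
  have hd := hnet z hzm hu2
  set u : Fin m → ℝ := fun i => η * (z i : ℝ) with hu
  have hdiff : euclNorm (u₀ - u) ≤ 1 / 2 := by
    refine (euclNorm_le_sqrt_card_mul hη0.le fun i => (hz i).2.1).trans_eq ?_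
    rw [Fintype.card_fin, hη]
    field_simp
  have h2 : ∑ i, u₀ i * x i = N := by
    have : ∑ i, u₀ i * x i = N⁻¹ * ∑ i, x i ^ 2 := by
      rw [Finset.mul_sum]
      exact Finset.sum_congr rfl fun i _ => by simp [hu₀]; ring
    rw [this, ← euclNorm_sq, ← hNd]
    field_simp
  have h3 : ∑ i, (u₀ - u) i * x i ≤ 1 / 2 * N :=
    (sum_mul_le_euclNorm _ _).trans (by gcongr)
  have h4 : N / 2 ≤ ∑ i, u i * x i := by
    have : ∑ i, (u₀ - u) i * x i = ∑ i, u₀ i * x i - ∑ i, u i * x i := by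
      rw [← Finset.sum_sub_distrib]
      exact Finset.sum_congr rfl fun i _ => by simp [sub_mul]
    linarith
  rw [hxd, sum_mul_matVec] at h4
  set g : Fin n → ℝ := fun j => ∑ i, A i j * u i with hg
  have h5 : ∑ j, g j * d j ≤ 2 * √L * ∑ j, |d j| +
      ∑ j, max (|g j| - 2 * √L) 0 * |d j| := by
    rw [Finset.mul_sum, ← Finset.sum_add_distrib]
    refine Finset.sum_le_sum fun j _ => ?_
    rw [← add_mul]
    refine (le_abs_self _).trans ?_
    rw [abs_mul]
    refine mul_le_mul_of_nonneg_right ?_ (abs_nonneg _)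
    linarith [le_max_left (|g j| - 2 * √L) 0]
  have h6 : ∑ j, max (|g j| - 2 * √L) 0 * |d j| ≤ 5 * √m * euclNorm d := by
    refine (sum_mul_le_euclNorm _ _).trans ?_
    have e1 : euclNorm (fun j => |d j|) = euclNorm d := by simp [euclNorm]
    rw [e1]
    refine mul_le_mul_of_nonneg_right ?_ (euclNorm_nonneg _)
    rw [euclNorm, Real.sqrt_le_left (by positivity)]
    refine hd.le.trans ?_
    nlinarith [hmm, Nat.cast_nonneg (α := ℝ) m]
  linarith

theorem measure_not_opBound_le {m n : ℕ} (hm : 0 < m) {L : ℝ} (hL : 0 ≤ L)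
    (hn : 2 * n * exp (-L) ≤ m) :
    gaussMatrixReal m n {A | ¬ OpBound A L} ≤ ENNReal.ofReal (exp (-m)) := by
  classical
  set η : ℝ := 1 / (2 * √m) with hη
  have hsub : {A : Fin m → Fin n → ℝ | ¬ OpBound A L} ⊆
      {A | ∃ z ∈ (intBall m (2 * m)).filter (fun z => ∑ i, (η * (z i : ℝ)) ^ 2 ≤ 1),
        24 * (m : ℝ) ≤ ∑ j, max (|∑ i, A i j * (η * (z i : ℝ))| - 2 * √L) 0 ^ 2} := by
    intro A hA
    simp only [Set.mem_ofPred_eq] at hA ⊢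
    by_contra! hcon
    exact hA (opBound_of_net hm fun z hz hz1 => hcon z (Finset.mem_filter.2 ⟨hz, hz1⟩))
  refine (measure_mono hsub).trans ((measure_exists_finset_le _ _ _ (a := 4 * m) (b := -5 * m)
    ?_ ?_).trans_eq (by ring_nf))
  · refine (Nat.cast_le.2 (Finset.card_filter_le _ _)).trans
      ((card_intBall_le le_rfl m (by positivity)).trans (Real.exp_le_exp.2 ?_))
    have h1 := Real.exp_one_gt_d9
    have h2 : exp (-1) * exp 1 = 1 := by rw [← Real.exp_add]; simp
    have h3 : exp (-1) ≤ 1 / 2 := by nlinarith [exp_pos (-1)]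
    have h4 := mul_le_mul_of_nonneg_left h3 (Nat.cast_nonneg (α := ℝ) m)
    linarith
  · intro z hz
    refine measure_cols_truncated_sq_le (fun i => η * (z i : ℝ)) (Finset.mem_filter.1 hz).2
      (by positivity) ?_
    rw [neg_div, mul_pow, Real.sq_sqrt hL]
    ring_nf at hn ⊢
    linarith

/-- Few rows are almost orthogonal to any of the integer vectors of the `ℓ₁` ball of radius `R`. -/
def FewSmall {m n : ℕ} (A : Fin m → Fin n → ℝ) (R : ℝ) : Prop :=
  ∀ z ∈ intBall n R, z ≠ 0 →
    (#{i | |matVec A (fun j => (z j : ℝ)) i| < exp (-13) * euclNorm (fun j => (z j : ℝ))} : ℝ) <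
      m / 4

theorem intCast_ne_zero_fun {d : ℕ} {z : Fin d → ℤ} (hz : z ≠ 0) : (fun j => (z j : ℝ)) ≠ 0 := by
  contrapose! hz
  ext j
  have := congrFun hz j
  simpa using this

theorem measure_not_fewSmall_le {m n : ℕ} {L : ℝ} (hL : 1 ≤ L)
    (hn : 6 * n * exp (-L) ≤ m) :
    gaussMatrixReal m n {A | ¬ FewSmall A (m / (4 * L))} ≤ ENNReal.ofReal (exp (-m)) := by
  classical
  have hsub : {A : Fin m → Fin n → ℝ | ¬ FewSmall A (m / (4 * L))} ⊆
      {A | ∃ z ∈ (intBall n (m / (4 * L))).filter (· ≠ 0), (m : ℝ) / 4 ≤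
        #{i | |matVec A (fun j => (z j : ℝ)) i| <
          exp (-13) * euclNorm (fun j => (z j : ℝ))}} := by
    intro A hA
    simp only [Set.mem_ofPred_eq] at hA ⊢
    by_contra! hcon
    exact hA fun z hz hz1 => hcon z (Finset.mem_filter.2 ⟨hz, hz1⟩)
  refine (measure_mono hsub).trans ((measure_exists_finset_le _ _ _ (a := m) (b := -2 * m)
    ?_ ?_).trans_eq (by ring_nf))
  · refine (Nat.cast_le.2 (Finset.card_filter_le _ _)).trans
      ((card_intBall_le hL n (by positivity)).trans (Real.exp_le_exp.2 ?_))
    have : L * (m / (4 * L)) = (m : ℝ) / 4 := by field_simp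
    rw [this]
    linarith
  · intro z hz
    exact measure_rows_small_le _ (euclNorm_pos (intCast_ne_zero_fun (Finset.mem_filter.1 hz).2))

/-- Many columns are well correlated with every integer vector of the `ℓ₁` ball of radius
`32 m`. -/
def ManyLarge {m n : ℕ} (A : Fin m → Fin n → ℝ) (t : ℝ) : Prop :=
  ∀ z ∈ intBall m (32 * m), z ≠ 0 →
    7 * (m : ℝ) < #{j | t * euclNorm (fun i => (z i : ℝ)) ≤ |∑ i, A i j * (z i : ℝ)|}

theorem measure_not_manyLarge_le {m n : ℕ} {t : ℝ} (hn : 84 * (m : ℝ) ≤ n * exp (-t ^ 2 - 3)) :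
    gaussMatrixReal m n {A | ¬ ManyLarge A t} ≤ ENNReal.ofReal (exp (-m)) := by
  classical
  have hsub : {A : Fin m → Fin n → ℝ | ¬ ManyLarge A t} ⊆
      {A | ∃ z ∈ (intBall m (32 * m)).filter (· ≠ 0),
        (#{j | t * euclNorm (fun i => (z i : ℝ)) ≤ |∑ i, A i j * (z i : ℝ)|} : ℝ) ≤ 7 * m} := by
    intro A hA
    simp only [Set.mem_ofPred_eq] at hA ⊢
    by_contra! hcon
    exact hA fun z hz hz1 => hcon z (Finset.mem_filter.2 ⟨hz, hz1⟩)
  refine (measure_mono hsub).trans ((measure_exists_finset_le _ _ _ (a := 34 * m) (b := -35 * m)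
    ?_ ?_).trans_eq (by ring_nf))
  · refine (Nat.cast_le.2 (Finset.card_filter_le _ _)).trans
      ((card_intBall_le le_rfl m (by positivity)).trans (Real.exp_le_exp.2 ?_))
    have h1 := Real.exp_one_gt_d9
    have h2 : exp (-1) * exp 1 = 1 := by rw [← Real.exp_add]; simp
    have h3 : exp (-1) ≤ 1 / 2 := by nlinarith [exp_pos (-1)]
    have h4 := mul_le_mul_of_nonneg_left h3 (Nat.cast_nonneg (α := ℝ) m)
    linarith
  · intro z hz
    refine (measure_cols_large_le _
      (euclNorm_pos (intCast_ne_zero_fun (Finset.mem_filter.1 hz).2)) t (7 * m)).trans ?_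
    apply ENNReal.ofReal_le_ofReal
    apply Real.exp_le_exp.2
    linarith

theorem le_euclNorm_of_abs_ge {ι : Type*} [Fintype ι] {q : ι → ℝ} {J : Finset ι} {b κ : ℝ}
    (hb : 0 ≤ b) (hκ : κ ^ 2 ≤ #J) (hJ : ∀ i ∈ J, b ≤ |q i|) :
    κ * b ≤ euclNorm q := by
  apply Real.le_sqrt_of_sq_le
  calc (κ * b) ^ 2 = κ ^ 2 * b ^ 2 := by ring
    _ ≤ #J * b ^ 2 := by gcongr
    _ = ∑ _i ∈ J, b ^ 2 := by simp
    _ ≤ ∑ i ∈ J, q i ^ 2 := Finset.sum_le_sum fun i hi => by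
        rw [← sq_abs (q i)]; exact pow_le_pow_left₀ hb (hJ i hi) 2
    _ ≤ ∑ i, q i ^ 2 := Finset.sum_le_sum_of_subset_of_nonneg (Finset.subset_univ J)
        fun _ _ _ => sq_nonneg _

theorem lower_bound_of_fewSmall {m n : ℕ} (hm : 0 < m) {A : Fin m → Fin n → ℝ} {L : ℝ}
    (hL : 1 ≤ L) (hA : OpBound A L) (hF : FewSmall A (m / (4 * L))) {ν : Fin n → ℝ}
    {w : Fin m → ℝ} {I : Finset (Fin m)} (hI : (m : ℝ) / 2 ≤ #I)
    (hw : ∀ i ∈ I, matVec A ν i = w i)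
    (hν : ∑ j, |ν j| ≤ exp (-13) / 192 * √(m / L) * euclNorm ν) :
    exp (-13) / 8 * √m * euclNorm ν ≤ euclNorm w := by
  classical
  by_cases hν0 : ν = 0
  · have : euclNorm ν = 0 := by simp [hν0, euclNorm]
    rw [this, mul_zero]
    exact euclNorm_nonneg _
  have hN := euclNorm_pos hν0
  set N := euclNorm ν with hNd
  have hL0 : 0 < L := by linarith
  have hmr : (0 : ℝ) < m := by exact_mod_cast hm
  have hr : 0 < √((m : ℝ) / L) := Real.sqrt_pos.2 (by positivity)
  have hrr : √((m : ℝ) / L) * √((m : ℝ) / L) = m / L := Real.mul_self_sqrt (by positivity)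
  have hsm : 0 < √(m : ℝ) := Real.sqrt_pos.2 hmr
  have hLr : √L * √((m : ℝ) / L) = √m := by
    rw [← Real.sqrt_mul hL0.le]
    congr 1
    field_simp
  have hc0 : 0 < exp (-13) := exp_pos _
  have hc1 : exp (-13) ≤ 1 := Real.exp_le_one_iff.2 (by norm_num)
  set c := exp (-13) with hc
  set ρ := √((m : ℝ) / L) with hρ
  set η : ℝ := c / 48 * N / ρ with hη
  have hη0 : 0 < η := by positivity
  obtain ⟨z, hz⟩ := exists_rounding hη0 ν
  have hzR : z ∈ intBall n (m / (4 * L)) := by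
    refine rounding_mem_intBall hη0 (fun i => (hz i).1) (hν.trans_eq ?_)
    rw [hη, show (m : ℝ) / (4 * L) = ρ * ρ / 4 by rw [hrr]; ring]
    field_simp
    norm_num
  set d : Fin n → ℝ := fun j => ν j - η * z j with hd
  set v : Fin n → ℝ := fun j => (z j : ℝ) with hv
  have hνd : ν = η • v + d := by ext j; simp [hd, hv]
  have hd1 : ∑ j, |d j| ≤ c / 192 * ρ * N :=
    (Finset.sum_le_sum fun j _ => (hz j).2.2).trans hν
  have hd2 : euclNorm d ≤ c / 96 * N := by
    rw [euclNorm, Real.sqrt_le_left (by positivity)]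
    calc ∑ j, d j ^ 2 ≤ ∑ j, η * |ν j| := Finset.sum_le_sum fun j _ => by
          rw [← sq_abs, sq]
          exact mul_le_mul (hz j).2.1 (hz j).2.2 (abs_nonneg _) hη0.le
      _ ≤ η * (c / 192 * ρ * N) := by rw [← Finset.mul_sum]; gcongr
      _ = (c / 96 * N) ^ 2 := by rw [hη]; field_simp; norm_num
  have hAd : euclNorm (matVec A d) ≤ c / 8 * √m * N := by
    refine (hA d).trans ?_
    calc 10 * √m * euclNorm d + 4 * √L * ∑ j, |d j|
        ≤ 10 * √m * (c / 96 * N) + 4 * √L * (c / 192 * ρ * N) := by gcongr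
      _ = 10 * √m * (c / 96 * N) + 4 * (√L * ρ) * (c / 192 * N) := by ring
      _ = c / 8 * √m * N := by rw [hLr]; ring
  have hvn : N / 2 ≤ euclNorm (η • v) := by
    have h1 : N ≤ euclNorm (η • v) + euclNorm d := by
      rw [hNd]
      conv_lhs => rw [hνd]
      exact euclNorm_add_le _ _
    nlinarith
  have hz0 : z ≠ 0 := by
    rintro rfl
    have : euclNorm (η • v) = 0 := by simp [hv, euclNorm]
    linarith
  have hcard := hF z hzR hz0
  set B : Finset (Fin m) := {i | |matVec A v i| < c * euclNorm v} with hB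
  have hJ : (√(m : ℝ) / 2) ^ 2 ≤ #(I \ B) := by
    have h1 : (#I : ℝ) ≤ #(I \ B) + #B := by
      exact_mod_cast Finset.card_le_card_sdiff_add_card
    rw [div_pow, Real.sq_sqrt hmr.le]
    linarith
  have h2 := le_euclNorm_of_abs_ge (q := w - matVec A d) (b := c * euclNorm (η • v))
    (by have := euclNorm_nonneg (η • v); positivity) hJ ?_
  · have h3 : euclNorm (w - matVec A d) ≤ euclNorm w + euclNorm (matVec A d) := by
      rw [sub_eq_add_neg, ← euclNorm_neg (matVec A d)]
      exact euclNorm_add_le _ _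
    have h4 : √m / 2 * (c * (N / 2)) ≤ √m / 2 * (c * euclNorm (η • v)) := by gcongr
    linarith
  · intro i hi
    rw [Finset.mem_sdiff] at hi
    have h5 : c * euclNorm v ≤ |matVec A v i| := by
      by_contra! h
      exact hi.2 (by simpa [hB] using h)
    have h6 : (w - matVec A d) i = η * matVec A v i := by
      rw [Pi.sub_apply, ← hw i hi.1]
      conv_lhs => rw [hνd]
      rw [matVec_add, matVec_smul]
      simp
    rw [h6, abs_mul, euclNorm_smul, abs_of_pos hη0]
    calc c * (η * euclNorm v) = η * (c * euclNorm v) := by ring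
      _ ≤ _ := by gcongr

theorem exists_large_column {m n : ℕ} (hm : 0 < m) {A : Fin m → Fin n → ℝ} {L : ℝ}
    (hL : 1 ≤ L) (hA : OpBound A L) (hF : ManyLarge A (√(L / 2))) {y : Fin m → ℝ} (hy : y ≠ 0) :
    ∃ j, √L / 4 * euclNorm y ≤ |∑ i, A i j * y i| := by
  classical
  have hN := euclNorm_pos hy
  set N := euclNorm y with hNd
  have hL0 : 0 < L := by linarith
  have hmr : (0 : ℝ) < m := by exact_mod_cast hm
  have hsm : 0 < √(m : ℝ) := Real.sqrt_pos.2 hmr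
  have hmm : √(m : ℝ) * √m = m := Real.mul_self_sqrt hmr.le
  have hsL : 1 ≤ √L := Real.one_le_sqrt.2 hL
  set η : ℝ := N / (32 * √m) with hη
  have hη0 : 0 < η := by positivity
  obtain ⟨z, hz⟩ := exists_rounding hη0 y
  have hzR : z ∈ intBall m (32 * m) := by
    refine rounding_mem_intBall hη0 (fun i => (hz i).1) ?_
    have h1 := sum_abs_le_sqrt_card_mul Finset.univ y
    rw [Finset.card_univ, Fintype.card_fin] at h1
    refine h1.trans_eq ?_
    rw [← hNd, hη]
    field_simp
    linarith
  set d : Fin m → ℝ := fun i => y i - η * z i with hd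
  set v : Fin m → ℝ := fun i => (z i : ℝ) with hv
  have hyd : y = η • v + d := by ext j; simp [hd, hv]
  have hd2 : euclNorm d ≤ N / 32 := by
    refine (euclNorm_le_sqrt_card_mul hη0.le fun i => (hz i).2.1).trans_eq ?_
    rw [Fintype.card_fin, hη]
    field_simp
  have hvn : 31 / 32 * N ≤ euclNorm (η • v) := by
    have h1 : N ≤ euclNorm (η • v) + euclNorm d := by
      rw [hNd]
      conv_lhs => rw [hyd]
      exact euclNorm_add_le _ _
    linarith
  have hz0 : z ≠ 0 := by
    rintro rfl
    have : euclNorm (η • v) = 0 := by simp [hv, euclNorm]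
    linarith
  have hcard := hF z hzR hz0
  set J : Finset (Fin n) := {j | √(L / 2) * euclNorm v ≤ |∑ i, A i j * v i|} with hJ
  have hgood : ∃ j ∈ J, |∑ i, A i j * d i| ≤ √L * N / 4 := by
    by_contra! hcon
    set δ : Fin n → ℝ := fun j => if j ∈ J then SignType.sign (∑ i, A i j * d i) else 0 with hδ
    have hδ1 : ∀ j, |δ j| ≤ if j ∈ J then 1 else 0 := by
      intro j
      by_cases hj : j ∈ J
      · simp only [hδ, hj, if_true]
        rcases SignType.trichotomy (SignType.sign (∑ i, A i j * d i)) with h | h | h <;>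
          simp [h]
      · simp [hδ, hj]
    have hl1 : ∑ j, |δ j| ≤ #J := (Finset.sum_le_sum fun j _ => hδ1 j).trans (by simp)
    have hl2 : euclNorm δ ≤ √(#J) := by
      apply Real.sqrt_le_sqrt
      calc ∑ j, δ j ^ 2 ≤ ∑ j, if j ∈ J then (1 : ℝ) else 0 := Finset.sum_le_sum fun j _ => by
            have := hδ1 j
            rw [← sq_abs]
            split_ifs at this ⊢
            · exact pow_le_one₀ (abs_nonneg _) this
            · nlinarith [abs_nonneg (δ j)]
        _ = #J := by simp
    have hlow : #J * (√L * N / 4) ≤ ∑ i, d i * matVec A δ i := by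
      rw [sum_mul_matVec, ← nsmul_eq_mul, ← Finset.sum_const]
      calc ∑ j ∈ J, √L * N / 4 ≤ ∑ j ∈ J, |∑ i, A i j * d i| :=
            Finset.sum_le_sum fun j hj => (hcon j hj).le
        _ = ∑ j ∈ J, (∑ i, A i j * d i) * δ j := Finset.sum_congr rfl fun j hj => by
            simp only [hδ, hj, if_true]
            exact (self_mul_sign _).symm
        _ = ∑ j, (∑ i, A i j * d i) * δ j :=
            Finset.sum_subset (Finset.subset_univ J) fun j _ hj => by
              rw [show δ j = 0 from if_neg hj, mul_zero]
    have hup := (sum_mul_le_euclNorm d (matVec A δ)).trans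
      (mul_le_mul hd2 (hA δ) (euclNorm_nonneg _) (by linarith))
    have hup2 : N / 32 * (10 * √m * euclNorm δ + 4 * √L * ∑ j, |δ j|) ≤
        N / 32 * (10 * √m * √(#J) + 4 * √L * #J) := by gcongr
    have h1 := (hlow.trans hup).trans hup2
    have hJ0 : (0 : ℝ) < #J := lt_trans (by positivity) hcard
    have hsJ : √(#J : ℝ) * √(#J) = #J := Real.mul_self_sqrt hJ0.le
    have hsJ0 : 0 < √(#J : ℝ) := Real.sqrt_pos.2 hJ0
    have h2 : 4 * √L * √(#J) * (N / 32 * √(#J)) ≤ 10 * √m * (N / 32 * √(#J)) := by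
      have e1 : 4 * √L * √(#J) * (N / 32 * √(#J)) =
          N / 32 * 4 * √L * (√(#J) * √(#J)) := by ring
      rw [e1, hsJ]
      linarith
    have h3 : 4 * √L * √(#J) ≤ 10 * √m :=
      le_of_mul_le_mul_right h2 (mul_pos (by linarith) hsJ0)
    have h4 : √(#J : ℝ) ≤ 5 / 2 * √m := by nlinarith
    have h5 : (#J : ℝ) ≤ 25 / 4 * m := by nlinarith
    linarith
  obtain ⟨j, hj, hjd⟩ := hgood
  refine ⟨j, ?_⟩
  have hj' : √(L / 2) * euclNorm v ≤ |∑ i, A i j * v i| := by simpa [hJ] using hj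
  have h1 : √(L / 2) * euclNorm (η • v) ≤ |η * ∑ i, A i j * v i| := by
    rw [abs_mul, euclNorm_smul, abs_of_pos hη0]
    calc √(L / 2) * (η * euclNorm v) = η * (√(L / 2) * euclNorm v) := by ring
      _ ≤ _ := by gcongr
  have h2 : ∑ i, A i j * y i = η * ∑ i, A i j * v i + ∑ i, A i j * d i := by
    rw [Finset.mul_sum, ← Finset.sum_add_distrib]
    refine Finset.sum_congr rfl fun i _ => ?_
    simp only [hd, hv]
    ring
  have h3 : 2 / 3 * √L ≤ √(L / 2) := by
    apply Real.le_sqrt_of_sq_le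
    rw [mul_pow, Real.sq_sqrt hL0.le]
    linarith
  have h4 : 2 / 3 * √L * (31 / 32 * N) ≤ √(L / 2) * euclNorm (η • v) := by gcongr
  have h5 : |η * ∑ i, A i j * v i| ≤ |∑ i, A i j * y i| + |∑ i, A i j * d i| := by
    have : η * ∑ i, A i j * v i = ∑ i, A i j * y i - ∑ i, A i j * d i := by rw [h2]; ring
    rw [this]
    exact abs_sub _ _
  have h6 : 0 < √L * N := by positivity
  nlinarith

/-- If every direction is `κ`-correlated with a column, then every vector is the image of a vector
of small `ℓ₁` norm. -/
theorem exists_matVec_eq_of_correlated {m n : ℕ} {A : Fin m → Fin n → ℝ} {κ : ℝ} (hκ : 0 < κ)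
    (h : ∀ y : Fin m → ℝ, y ≠ 0 → ∃ j, κ * euclNorm y ≤ |∑ i, A i j * y i|) (e : Fin m → ℝ) :
    ∃ w, matVec A w = e ∧ ∑ j, |w j| ≤ euclNorm e / κ := by
  classical
  set r := euclNorm e / κ with hr
  have hr0 : 0 ≤ r := div_nonneg (euclNorm_nonneg _) hκ.le
  set B : Set (Fin n → ℝ) := {w | ∑ j, |w j| ≤ r} with hB
  have hBc : IsCompact B := by
    refine Metric.isCompact_of_isClosed_isBounded
      (isClosed_le (by fun_prop) continuous_const) ?_
    refine (Metric.isBounded_closedBall (x := (0 : Fin n → ℝ)) (r := r)).subset fun w hw => ?_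
    rw [mem_closedBall_zero_iff, pi_norm_le_iff_of_nonneg hr0]
    intro j
    exact (Finset.single_le_sum (f := fun j => |w j|) (fun _ _ => abs_nonneg _)
      (Finset.mem_univ j)).trans hw
  have hBv : Convex ℝ B := by
    intro x hx y hy a b ha hb hab
    have hx' : ∑ j, |x j| ≤ r := hx
    have hy' : ∑ j, |y j| ≤ r := hy
    have h1 : ∑ j, |(a • x + b • y) j| ≤ a * ∑ j, |x j| + b * ∑ j, |y j| := by
      rw [Finset.mul_sum, Finset.mul_sum, ← Finset.sum_add_distrib]
      refine Finset.sum_le_sum fun j _ => ?_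
      simp only [Pi.add_apply, Pi.smul_apply, smul_eq_mul]
      refine (abs_add_le _ _).trans_eq ?_
      rw [abs_mul, abs_mul, abs_of_nonneg ha, abs_of_nonneg hb]
    have h2 : a * ∑ j, |x j| + b * ∑ j, |y j| ≤ a * r + b * r := by gcongr
    exact (h1.trans h2).trans_eq (by rw [← add_mul, hab, one_mul])
  let T : (Fin n → ℝ) →ₗ[ℝ] (Fin m → ℝ) :=
    { toFun := matVec A
      map_add' := matVec_add A
      map_smul' := fun c d => matVec_smul A c d }
  by_contra hcon
  have he : e ∉ T '' B := by
    rintro ⟨w, hw, hwe⟩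
    exact hcon ⟨w, hwe, hw⟩
  obtain ⟨f, u, hfu, hue⟩ := geometric_hahn_banach_closed_point (hBv.linear_image T)
    (hBc.image T.continuous_of_finiteDimensional).isClosed he
  set y : Fin m → ℝ := fun i => f (Pi.single i 1) with hy
  have hf : ∀ x, f x = ∑ i, y i * x i := by
    intro x
    have := LinearMap.pi_apply_eq_sum_univ (f : (Fin m → ℝ) →ₗ[ℝ] ℝ) x
    simp only [ContinuousLinearMap.coe_coe, smul_eq_mul] at this
    rw [this]
    refine Finset.sum_congr rfl fun i _ => ?_
    rw [mul_comm, hy]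
    congr 2
    ext k
    simp [Pi.single_apply, eq_comm]
  have hu0 : 0 < u := by
    have := hfu (T 0) ⟨0, by simpa [hB] using hr0, rfl⟩
    simpa using this
  have hy0 : y ≠ 0 := by
    intro h0
    rw [hf, h0] at hue
    simp at hue
    linarith
  obtain ⟨j, hj⟩ := h y hy0
  have hs : ∀ s : ℝ, |s| ≤ r → s * ∑ i, A i j * y i < u := by
    intro s hs
    have hmem : Pi.single j s ∈ B := by
      simp only [hB, Set.mem_ofPred_eq]
      rw [Finset.sum_eq_single j (by intro b _ hb; simp [hb]) (by simp)]
      simpa using hs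
    have h1 := hfu _ ⟨_, hmem, rfl⟩
    have h2 : T (Pi.single j s) = matVec A (Pi.single j s) := rfl
    rw [h2, hf, sum_mul_matVec, Finset.sum_eq_single j (by intro b _ hb; simp [hb]) (by simp),
      Pi.single_eq_same, mul_comm] at h1
    exact h1
  have h3 : r * |∑ i, A i j * y i| < u := by
    rcases abs_choice (∑ i, A i j * y i) with h4 | h4 <;> rw [h4]
    · exact hs r (abs_of_nonneg hr0).le
    · have := hs (-r) (by rw [abs_neg, abs_of_nonneg hr0])
      linarith
  have h5 : f e ≤ euclNorm y * euclNorm e := by rw [hf]; exact sum_mul_le_euclNorm _ _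
  have h6 : r * (κ * euclNorm y) ≤ r * |∑ i, A i j * y i| := by gcongr
  have h7 : r * (κ * euclNorm y) = euclNorm y * euclNorm e := by rw [hr]; field_simp
  linarith

theorem euclNorm_sub_le_of_agree {m n : ℕ} (hm : 0 < m) {A : Fin m → Fin n → ℝ} {L Q : ℝ}
    (hL : 1 ≤ L) (hQ : 0 ≤ Q) (hA : OpBound A L) (hF : FewSmall A (m / (4 * L)))
    {x₀ xs h w : Fin n → ℝ} {S : Finset (Fin n)} (hh : ∀ j, h j = if j ∈ S then 0 else x₀ j)
    (hS : 2 * √(#S) ≤ exp (-13) / 384 * √(m / L))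
    (hAh : euclNorm (matVec A h) ≤ 3 * √m * euclNorm h)
    (hw : ∑ j, |w j| ≤ Q * √(m / L) * euclNorm h)
    (hmin : ∑ j, |xs j| ≤ ∑ j, |x₀ j - h j + w j|)
    {I : Finset (Fin m)} (hI : (m : ℝ) / 2 ≤ #I)
    (hxs : ∀ i ∈ I, matVec A xs i = matVec A x₀ i) :
    euclNorm (xs - x₀) ≤ (384 * Q / exp (-13) + 24 / exp (-13) + 1) * euclNorm h := by
  have hmr : (0 : ℝ) < m := by exact_mod_cast hm
  have hsm : 0 < √(m : ℝ) := Real.sqrt_pos.2 hmr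
  have hσ := euclNorm_nonneg h
  set ν : Fin n → ℝ := xs - (x₀ - h) with hν
  have hN := euclNorm_nonneg ν
  have hc : 0 < exp (-13) := exp_pos _
  have hν1 : ∑ j, |ν j| ≤ 2 * ∑ j ∈ S, |ν j| + ∑ j, |w j| := by
    have h1 : ∑ j, |x₀ j - h j + w j| ≤ ∑ j, |x₀ j - h j| + ∑ j, |w j| := by
      rw [← Finset.sum_add_distrib]
      exact Finset.sum_le_sum fun j _ => abs_add_le _ _
    have h2 : ∑ j, |x₀ j - h j| + ∑ j, |ν j| ≤ ∑ j, |xs j| + 2 * ∑ j ∈ S, |ν j| := by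
      have h3 : ∑ j ∈ S, |ν j| = ∑ j, if j ∈ S then |ν j| else 0 := by simp
      rw [h3, Finset.mul_sum, ← Finset.sum_add_distrib, ← Finset.sum_add_distrib]
      refine Finset.sum_le_sum fun j _ => ?_
      have hνj : ν j = xs j - (x₀ j - h j) := rfl
      by_cases hj : j ∈ S
      · have := abs_sub_abs_le_abs_sub (x₀ j - h j) (xs j)
        rw [abs_sub_comm (x₀ j - h j), ← hνj] at this
        simp only [hj, if_true]
        linarith
      · have h0 : x₀ j - h j = 0 := by rw [hh, if_neg hj, sub_self]
        simp [hνj, h0, hj]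
    linarith
  have hSν : 2 * ∑ j ∈ S, |ν j| ≤ exp (-13) / 384 * √(m / L) * euclNorm ν := by
    calc 2 * ∑ j ∈ S, |ν j| ≤ 2 * (√(#S) * euclNorm ν) := by
          gcongr; exact sum_abs_le_sqrt_card_mul S ν
      _ = 2 * √(#S) * euclNorm ν := by ring
      _ ≤ _ := by gcongr
  have hνb : euclNorm ν ≤ (384 * Q / exp (-13) + 24 / exp (-13)) * euclNorm h := by
    rcases le_total (Q * euclNorm h) (exp (-13) / 384 * euclNorm ν) with hle | hle
    · have h1 : ∑ j, |ν j| ≤ exp (-13) / 192 * √(m / L) * euclNorm ν := by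
        have := mul_le_mul_of_nonneg_right hle (Real.sqrt_nonneg (m / L))
        linarith
      have h2 := lower_bound_of_fewSmall hm hL hA hF hI (w := matVec A h) (fun i hi => by
        rw [hν, matVec_sub, matVec_sub, Pi.sub_apply, Pi.sub_apply, hxs i hi]
        ring) h1
      have h3 : exp (-13) / 8 * euclNorm ν ≤ 3 * euclNorm h := by
        refine le_of_mul_le_mul_left ?_ hsm
        linarith
      have h4 : euclNorm ν ≤ 24 / exp (-13) * euclNorm h := by
        rw [div_mul_eq_mul_div, le_div_iff₀ hc]
        linarith
      have h5 : 0 ≤ 384 * Q / exp (-13) * euclNorm h := by positivity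
      linarith
    · have h4 : euclNorm ν ≤ 384 * Q / exp (-13) * euclNorm h := by
        rw [div_mul_eq_mul_div, le_div_iff₀ hc]
        linarith
      have h5 : 0 ≤ 24 / exp (-13) * euclNorm h := by positivity
      linarith
  have h6 : xs - x₀ = ν + -h := by rw [hν]; abel
  have h7 := euclNorm_add_le ν (-h)
  rw [euclNorm_neg, ← h6] at h7
  linarith

theorem euclNorm_sub_or_add_le_of_minimizer {m n : ℕ} (hm : 0 < m) {A : Fin m → Fin n → ℝ}
    {L Q : ℝ} (hL : 1 ≤ L) (hQ : 0 ≤ Q) (hA : OpBound A L) (hF : FewSmall A (m / (4 * L)))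
    {x₀ xs h w : Fin n → ℝ} {S : Finset (Fin n)} (hh : ∀ j, h j = if j ∈ S then 0 else x₀ j)
    (hS : 2 * √(#S) ≤ exp (-13) / 384 * √(m / L))
    (hAh : euclNorm (matVec A h) ≤ 3 * √m * euclNorm h)
    (hAw : matVec A w = matVec A h) (hw : ∑ j, |w j| ≤ Q * √(m / L) * euclNorm h)
    (hxs : ∀ i, |matVec A xs i| = |matVec A x₀ i|)
    (hmin : ∀ z : Fin n → ℝ, (∀ i, |matVec A z i| = |matVec A x₀ i|) →
      ∑ j, |xs j| ≤ ∑ j, |z j|) :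
    euclNorm (xs - x₀) ≤ (384 * Q / exp (-13) + 24 / exp (-13) + 1) * euclNorm h ∨
      euclNorm (xs + x₀) ≤ (384 * Q / exp (-13) + 24 / exp (-13) + 1) * euclNorm h := by
  classical
  have hmin' : ∑ j, |xs j| ≤ ∑ j, |x₀ j - h j + w j| :=
    hmin (x₀ - h + w) fun i => by rw [matVec_add, matVec_sub, hAw, sub_add_cancel]
  set I : Finset (Fin m) := {i | matVec A xs i = matVec A x₀ i} with hI
  set I' : Finset (Fin m) := {i | matVec A (-xs) i = matVec A x₀ i} with hI'
  have hcard : (m : ℝ) ≤ #I + #I' := by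
    have h1 : (Finset.univ : Finset (Fin m)) ⊆ I ∪ I' := by
      intro i _
      rcases abs_eq_abs.1 (hxs i) with h1 | h1
      · simp [hI, h1]
      · refine Finset.mem_union_right _ ?_
        simp [hI', matVec_neg, h1]
    have h2 := (Finset.card_le_card h1).trans (Finset.card_union_le _ _)
    rw [Finset.card_univ, Fintype.card_fin] at h2
    exact_mod_cast h2
  rcases le_or_gt ((m : ℝ) / 2) #I with hle | hlt
  · exact Or.inl (euclNorm_sub_le_of_agree hm hL hQ hA hF hh hS hAh hw hmin' hle
      fun i hi => by simpa [hI] using hi)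
  · right
    have h3 := euclNorm_sub_le_of_agree hm hL hQ hA hF (xs := -xs) hh hS hAh hw
      (by simpa using hmin') (I := I') (by linarith) fun i hi => by simpa [hI'] using hi
    rwa [← neg_add', euclNorm_neg] at h3

theorem lpNorm_two_eq_euclNorm {ι : Type*} [Fintype ι] (x : ι → ℝ) : lpNorm 2 x = euclNorm x := by
  rw [_root_.lpNorm, euclNorm, Real.sqrt_eq_rpow]
  congr 1
  refine Finset.sum_congr rfl fun i _ => ?_
  rw [Real.rpow_two, Real.norm_eq_abs, sq_abs]

theorem lpNorm_one_eq_sum_abs {ι : Type*} [Fintype ι] (x : ι → ℝ) : lpNorm 1 x = ∑ i, |x i| := by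
  simp [_root_.lpNorm]

theorem phaseDist_two_le {ι : Type*} [Fintype ι] {x y : ι → ℝ} {r : ℝ}
    (h : euclNorm (x - y) ≤ r ∨ euclNorm (x + y) ≤ r) : phaseDist 2 x y ≤ r := by
  have hbdd : BddBelow {d | ∃ c : ℝ, ‖c‖ = 1 ∧ d = lpNorm 2 (fun i => x i - c * y i)} := by
    refine ⟨0, ?_⟩
    rintro d ⟨c, -, rfl⟩
    rw [lpNorm_two_eq_euclNorm]
    exact euclNorm_nonneg _
  rcases h with h | h
  · refine (csInf_le hbdd ⟨1, by simp, rfl⟩).trans ?_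
    rw [lpNorm_two_eq_euclNorm]
    rw [show (fun i => x i - 1 * y i) = x - y by ext i; simp]
    exact h
  · refine (csInf_le hbdd ⟨-1, by simp, rfl⟩).trans ?_
    rw [lpNorm_two_eq_euclNorm]
    rw [show (fun i => x i - -1 * y i) = x + y by ext i; simp]
    exact h

theorem exists_finset_euclNorm_le_sigmaK {n : ℕ} (k : ℕ) (x : Fin n → ℝ) :
    ∃ S : Finset (Fin n), #S ≤ k ∧ euclNorm (fun j => if j ∈ S then 0 else x j) ≤ sigmaK k 2 x := by
  classical
  obtain ⟨S, hS, hmin⟩ := Finset.exists_min_image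
    ({S | #S ≤ k} : Finset (Finset (Fin n)))
    (fun S => euclNorm (fun j => if j ∈ S then 0 else x j)) ⟨∅, by simp⟩
  refine ⟨S, by simpa using hS, le_csInf ⟨_, 0, by simp [l0Norm], rfl⟩ ?_⟩
  rintro d ⟨z, hz, rfl⟩
  rw [lpNorm_two_eq_euclNorm]
  refine (hmin (Finset.univ.filter fun i => z i ≠ 0) ?_).trans (euclNorm_le_of_abs_le fun j => ?_)
  · rw [Finset.mem_filter]
    refine ⟨Finset.mem_univ _, ?_⟩
    refine le_of_eq_of_le ?_ hz
    rw [l0Norm]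
  · by_cases hj : z j = 0 <;> simp [hj]

theorem exists_matVec_eq_sum_abs_le {m n : ℕ} (hm : 0 < m) {A : Fin m → Fin n → ℝ} {L : ℝ}
    (hL : 1 ≤ L) (hLn : n * exp (-L) = m * exp (-2)) (hA : OpBound A L)
    (hF : exp 18 * m < n → ManyLarge A (√(L / 2))) {h : Fin n → ℝ}
    (hAh : euclNorm (matVec A h) ≤ 3 * √m * euclNorm h) :
    ∃ w, matVec A w = matVec A h ∧ ∑ j, |w j| ≤ 5 * exp 9 * √(m / L) * euclNorm h := by
  have hL0 : 0 < L := by linarith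
  have hmr : (0 : ℝ) < m := by exact_mod_cast hm
  have hσ := euclNorm_nonneg h
  rcases le_or_gt (n : ℝ) (exp 18 * m) with hle | hlt
  · refine ⟨h, rfl, ?_⟩
    have h1 := sum_abs_le_sqrt_card_mul Finset.univ h
    rw [Finset.card_univ, Fintype.card_fin] at h1
    refine h1.trans (mul_le_mul_of_nonneg_right ?_ hσ)
    have hL20 : L ≤ 20 := by
      have h2 : m * exp (-2) ≤ m * exp (18 - L) := by
        rw [← hLn, sub_eq_add_neg, Real.exp_add]
        calc n * exp (-L) ≤ exp 18 * m * exp (-L) := by gcongr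
          _ = _ := by ring
      have h3 := Real.exp_le_exp.1 (le_of_mul_le_mul_left h2 hmr)
      linarith
    rw [Real.sqrt_le_left (by positivity), mul_pow, Real.sq_sqrt (by positivity), mul_pow,
      ← Real.exp_nat_mul, ← mul_div_assoc, le_div_iff₀ hL0]
    norm_num
    calc n * L ≤ exp 18 * m * 20 := by gcongr
      _ ≤ 25 * exp 18 * m := by nlinarith [mul_pos (exp_pos 18) hmr]
  · obtain ⟨w, hw, hw1⟩ := exists_matVec_eq_of_correlated (κ := √L / 4) (by positivity)
      (fun y hy => exists_large_column hm hL hA (hF hlt) hy) (matVec A h)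
    refine ⟨w, hw, hw1.trans ?_⟩
    have h9 : (10 : ℝ) ≤ exp 9 := by linarith [Real.add_one_le_exp (9 : ℝ)]
    calc euclNorm (matVec A h) / (√L / 4) ≤ 3 * √m * euclNorm h / (√L / 4) := by gcongr
      _ = 12 * (√m / √L) * euclNorm h := by field_simp; ring
      _ = 12 * √(m / L) * euclNorm h := by rw [Real.sqrt_div hmr.le]
      _ ≤ _ := by gcongr; linarith

theorem measure_not_good_le {m n : ℕ} (hm : 0 < m) {L : ℝ} (hL : 1 ≤ L)
    (hLn : n * exp (-L) = m * exp (-2)) (h : Fin n → ℝ) :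
    gaussMatrixReal m n {A | ¬ (OpBound A L ∧ FewSmall A (m / (4 * L)) ∧
      euclNorm (matVec A h) ≤ 3 * √m * euclNorm h ∧
      (exp 18 * m < n → ManyLarge A (√(L / 2))))} ≤ ENNReal.ofReal (4 * exp (-m)) := by
  have hmr : (0 : ℝ) < m := by exact_mod_cast hm
  have h2 : 6 * exp (-2) ≤ 1 := by
    rw [Real.exp_neg, ← div_eq_mul_inv, div_le_one (exp_pos _)]
    have := Real.exp_one_gt_d9
    rw [show (2 : ℝ) = 1 + 1 by norm_num, Real.exp_add]
    nlinarith
  have hsub : {A : Fin m → Fin n → ℝ | ¬ (OpBound A L ∧ FewSmall A (m / (4 * L)) ∧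
      euclNorm (matVec A h) ≤ 3 * √m * euclNorm h ∧
      (exp 18 * m < n → ManyLarge A (√(L / 2))))} ⊆
      (({A | ¬ OpBound A L} ∪ {A | ¬ FewSmall A (m / (4 * L))}) ∪
        {A | 8 * (m : ℝ) * ∑ j, h j ^ 2 < ∑ i, (∑ j, A i j * h j) ^ 2}) ∪
        {A | exp 18 * m < n ∧ ¬ ManyLarge A (√(L / 2))} := by
    intro A hA
    by_contra hcon
    simp only [Set.mem_union, Set.mem_ofPred_eq, not_or, not_not, not_and, not_lt] at hcon
    obtain ⟨⟨⟨h1, h3⟩, h4⟩, h5⟩ := hcon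
    refine hA ⟨h1, h3, ?_, h5⟩
    rw [euclNorm, Real.sqrt_le_left (mul_nonneg (by positivity) (euclNorm_nonneg _)), mul_pow,
      mul_pow, euclNorm_sq, Real.sq_sqrt hmr.le]
    have h6 : (0 : ℝ) ≤ m * ∑ j, h j ^ 2 :=
      mul_nonneg hmr.le (Finset.sum_nonneg fun _ _ => sq_nonneg _)
    simp only [matVec]
    linarith
  have hlarge : gaussMatrixReal m n {A | exp 18 * m < n ∧ ¬ ManyLarge A (√(L / 2))} ≤
      ENNReal.ofReal (exp (-m)) := by
    by_cases hn : exp 18 * m < n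
    · simp only [hn, true_and]
      apply measure_not_manyLarge_le
      rw [Real.sq_sqrt (by linarith), sub_eq_add_neg, Real.exp_add]
      have h5 : exp 8 * m ≤ n * exp (-(L / 2)) := by
        refine le_of_sq_le_sq ?_ (by positivity)
        rw [mul_pow, mul_pow, ← Real.exp_nat_mul, ← Real.exp_nat_mul]
        calc exp ((2 : ℕ) * 8) * m ^ 2 = m * exp (-2) * (exp 18 * m) := by
              rw [show ((2 : ℕ) : ℝ) * 8 = -2 + 18 by norm_num, Real.exp_add]; ring
          _ ≤ n * exp (-L) * n := by rw [← hLn]; gcongr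
          _ = _ := by
            rw [show ((2 : ℕ) : ℝ) * -(L / 2) = -L by push_cast; ring]; ring
      have h6 : (84 : ℝ) ≤ exp 5 := by
        have h7 := Real.exp_one_gt_d9
        calc (84 : ℝ) ≤ 2.7 ^ 5 := by norm_num
          _ ≤ exp 1 ^ 5 := by gcongr; linarith
          _ = exp 5 := by rw [← Real.exp_nat_mul]; norm_num
      calc 84 * (m : ℝ) ≤ exp 5 * m := by gcongr
        _ = exp 8 * m * exp (-3) := by
          rw [show (5 : ℝ) = 8 + -3 by norm_num, Real.exp_add]; ring
        _ ≤ n * exp (-(L / 2)) * exp (-3) := by gcongr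
        _ = _ := by ring
    · simp [hn]
  have he := (exp_pos (-(m : ℝ))).le
  calc _ ≤ _ := measure_mono hsub
    _ ≤ _ := measure_union_le _ _
    _ ≤ _ := add_le_add_left ((measure_union_le _ _).trans
        (add_le_add_left (measure_union_le _ _) _)) _
    _ ≤ ENNReal.ofReal (exp (-m)) + ENNReal.ofReal (exp (-m)) + ENNReal.ofReal (exp (-m)) +
        ENNReal.ofReal (exp (-m)) := by
      gcongr
      · exact measure_not_opBound_le hm (by linarith) (by
          rw [mul_assoc, hLn]; nlinarith [mul_pos hmr (exp_pos (-2))])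
      · exact measure_not_fewSmall_le hL (by rw [mul_assoc, hLn]; nlinarith)
      · exact measure_rows_sq_le h
    _ = _ := by
      rw [← ENNReal.ofReal_add he he, ← ENNReal.ofReal_add (by positivity) he,
        ← ENNReal.ofReal_add (by positivity) he]
      congr 1
      ring

/-- Theorem `th:22`, real case: non-uniform `(2,2)`-instance optimality. For a
fixed `x₀ ∈ ℝ^n` and a standard Gaussian random matrix `A ∈ ℝ^{m×n}` with
`C·k·log(en/k) ≤ m`, with probability at least
`1 - c̃₃·exp(-c̃₂ m) - exp(-√(mn)) - 2m·exp(-c̃₁ m/log(en/m))`, every `ℓ₁` minimizer `x♯`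
subject to `|Ax♯| = |Ax₀|` satisfies `dist(x♯, x₀) ≤ C'·σ_k(x₀)₂`. -/
theorem stmt13 :
    ∃ C C' c₁ c₂ c₃ : ℝ, 0 < C ∧ 0 < C' ∧ 0 < c₁ ∧ 0 < c₂ ∧ 0 < c₃ ∧
      ∀ k n m : ℕ, 0 < k → k ≤ n →
        C * k * Real.log (Real.exp 1 * n / k) ≤ m →
        ∀ x₀ : Fin n → ℝ,
          ENNReal.ofReal (1 - c₃ * Real.exp (-c₂ * m) - Real.exp (-Real.sqrt (m * n))
              - 2 * m * Real.exp (-c₁ * m / Real.log (Real.exp 1 * n / m))) ≤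
            gaussMatrixReal m n
              {A : Fin m → Fin n → ℝ | ∀ xs : Fin n → ℝ,
                (∀ i, absMv A xs i = absMv A x₀ i) →
                (∀ z : Fin n → ℝ, (∀ i, absMv A z i = absMv A x₀ i) →
                  lpNorm 1 xs ≤ lpNorm 1 z) →
                phaseDist 2 xs x₀ ≤ C' * sigmaK k 2 x₀} := by
  refine ⟨2 * (768 / Real.exp (-13)) ^ 2,
    384 * (5 * Real.exp 9) / Real.exp (-13) + 24 / Real.exp (-13) + 1, 1, 1, 4,
    by positivity, by positivity, one_pos, one_pos, by norm_num, ?_⟩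
  intro k n m hk hkn hkm x₀
  have hkr : (1 : ℝ) ≤ k := by exact_mod_cast hk
  have hknr : (k : ℝ) ≤ n := by exact_mod_cast hkn
  have hk0 : (0 : ℝ) < k := by linarith
  have hn0 : (0 : ℝ) < n := by linarith
  have hlogk : Real.log (Real.exp 1 * n / k) = 1 + Real.log (n / k) := by
    rw [mul_div_assoc, Real.log_mul (Real.exp_pos _).ne' (by positivity), Real.log_exp]
  have hlogk0 : 0 ≤ Real.log ((n : ℝ) / k) := Real.log_nonneg (by rwa [one_le_div hk0])
  rw [hlogk] at hkm
  have hc1 : Real.exp (-13) ≤ 1 := Real.exp_le_one_iff.2 (by norm_num)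
  have hC1 : 1 ≤ 2 * (768 / Real.exp (-13)) ^ 2 := by
    have h1 : 1 ≤ 768 / Real.exp (-13) := by
      rw [one_le_div (Real.exp_pos _)]
      linarith
    nlinarith
  have hkm' : (k : ℝ) ≤ m := by
    refine le_trans ?_ hkm
    have h1 : 1 * (k : ℝ) * 1 ≤ 2 * (768 / Real.exp (-13)) ^ 2 * k * (1 + Real.log (n / k)) := by
      gcongr
      linarith
    linarith
  have hmr : (0 : ℝ) < m := by linarith
  have hm : 0 < m := by exact_mod_cast hmr
  have hlogm : Real.log (Real.exp 1 * n / m) = 1 + Real.log (n / m) := by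
    rw [mul_div_assoc, Real.log_mul (Real.exp_pos _).ne' (by positivity), Real.log_exp]
  rw [hlogm]
  rcases le_or_gt (1 + Real.log ((n : ℝ) / m)) 0 with hneg | hpos
  · have h1 : 1 ≤ Real.exp (-1 * m / (1 + Real.log (n / m))) :=
      Real.one_le_exp (div_nonneg_of_nonpos (by linarith) hneg)
    have h2 : (1 : ℝ) ≤ m := by exact_mod_cast hm
    have h3 : 0 < Real.exp (-1 * m) := Real.exp_pos _
    have h4 : 0 < Real.exp (-Real.sqrt (m * n)) := Real.exp_pos _
    rw [ENNReal.ofReal_of_nonpos (by nlinarith)]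
    exact zero_le
  set L : ℝ := 2 + Real.log (n / m) with hLdef
  have hL : 1 ≤ L := by linarith
  have hL0 : 0 < L := by linarith
  have hLn : n * Real.exp (-L) = m * Real.exp (-2) := by
    rw [hLdef, neg_add, Real.exp_add, Real.exp_neg (Real.log _), Real.exp_log (by positivity)]
    field_simp
  obtain ⟨S, hS, hσ⟩ := exists_finset_euclNorm_le_sigmaK k x₀
  set h : Fin n → ℝ := fun j => if j ∈ S then 0 else x₀ j with hh
  have hSk : 2 * √(#S) ≤ Real.exp (-13) / 384 * √(m / L) := by
    have hLk : L ≤ 2 * (1 + Real.log (n / k)) := by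
      have : Real.log ((n : ℝ) / m) ≤ Real.log (n / k) := by gcongr
      linarith
    have h1 : (768 / Real.exp (-13)) ^ 2 * k ≤ m / L := by
      rw [le_div_iff₀ hL0]
      refine le_trans ?_ hkm
      calc (768 / Real.exp (-13)) ^ 2 * k * L
          ≤ (768 / Real.exp (-13)) ^ 2 * k * (2 * (1 + Real.log (n / k))) := by gcongr
        _ = _ := by ring
    have h2 : 768 / Real.exp (-13) * √k ≤ √(m / L) := by
      apply Real.le_sqrt_of_sq_le
      rwa [mul_pow, Real.sq_sqrt hk0.le]
    have h3 : √(#S : ℝ) ≤ √k := Real.sqrt_le_sqrt (by exact_mod_cast hS)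
    calc 2 * √(#S : ℝ) ≤ 2 * √k := by gcongr
      _ = Real.exp (-13) / 384 * (768 / Real.exp (-13) * √k) := by
        field_simp
        norm_num
      _ ≤ _ := by gcongr
  have hbad := measure_not_good_le hm hL hLn h
  set G : Set (Fin m → Fin n → ℝ) := {A | OpBound A L ∧ FewSmall A (m / (4 * L)) ∧
      euclNorm (matVec A h) ≤ 3 * √m * euclNorm h ∧
      (Real.exp 18 * m < n → ManyLarge A (√(L / 2)))} with hG
  have hGle : ENNReal.ofReal (1 - 4 * Real.exp (-m)) ≤ gaussMatrixReal m n G := by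
    rw [ENNReal.ofReal_sub _ (by positivity), ENNReal.ofReal_one, tsub_le_iff_right,
      ← measure_univ (μ := gaussMatrixReal m n), ← Set.union_compl_self G]
    exact (measure_union_le _ _).trans (add_le_add_right hbad _)
  refine (ENNReal.ofReal_le_ofReal ?_).trans (hGle.trans (measure_mono ?_))
  · have h1 := Real.exp_pos (-Real.sqrt (m * n))
    have h2 : 0 ≤ 2 * m * Real.exp (-1 * m / (1 + Real.log (n / m))) := by positivity
    rw [neg_one_mul] at h2 ⊢
    linarith
  · rintro A ⟨hA, hF, hAh, hM⟩ xs hxs hmin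
    obtain ⟨w, hAw, hw⟩ := exists_matVec_eq_sum_abs_le hm hL hLn hA hM hAh
    refine (phaseDist_two_le (euclNorm_sub_or_add_le_of_minimizer hm hL (by positivity) hA hF
      (fun j => rfl) hSk hAh hAw hw hxs fun z hz => ?_)).trans ?_
    · simpa only [lpNorm_one_eq_sum_abs] using hmin z hz
    · gcongr
end
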